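/- arXiv:1902.02151 — 2 statements merged into one kernel-verified Lean document; each statement's English description precedes it below -/
import Mathlib

section
/- For each ω ∈ W_0 and a ∈ S_ω there exists a unique I_1-invariant function f_{ω,a} ∈ ind_{KZ}^G σ supported on the coset KZ t_a I_1 with f_{ω,a}(ω t_a) = v_0; moreover the family {f_{ω,a} : ω ∈ W_0, a ∈ S_ω} is a \bar{𝔽}_p-basis of the space (ind_{KZ}^G σ)^{I_1} of I_1-fixed vectors. -/
open Matrix

noncomputable section

namespace IH

variable (p : ℕ) [Fact p.Prime]

/-- `\bar{𝔽}_p`, an algebraic closure of the residue field. -/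
abbrev kb := AlgebraicClosure (ZMod p)

variable (N : ℕ)

/-- `G = GL_N(F)` with `F = ℚ_p`. -/
abbrev GG := GL (Fin N) ℚ_[p]
/-- `GL_N(O_F)` (as an abstract group, mapping onto `K ⊆ G`). -/
abbrev MM := GL (Fin N) ℤ_[p]
/-- `GL_N(k_F)`. -/
abbrev Gk := GL (Fin N) (ZMod p)

/-- The inclusion `GL_N(O_F) → GL_N(F)`. -/
def iotaM : MM p N →* GG p N := Matrix.GeneralLinearGroup.map (PadicInt.Coe.ringHom)

/-- The reduction map `red : GL_N(O_F) → GL_N(k_F)`. -/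
def redM : MM p N →* Gk p N := Matrix.GeneralLinearGroup.map (PadicInt.toZMod)

/-- Elements of `GL_N(O_F)` whose reduction is upper triangular: the Iwahori condition. -/
def Ipre : Set (MM p N) :=
  {m | ∀ i j : Fin N, j < i → ((redM p N m : Matrix (Fin N) (Fin N) (ZMod p)) i j = 0)}

/-- Elements of `GL_N(O_F)` whose reduction is upper triangular unipotent: pro-p Iwahori. -/
def I1pre : Set (MM p N) :=
  {m | m ∈ Ipre p N ∧ ∀ i : Fin N, ((redM p N m : Matrix (Fin N) (Fin N) (ZMod p)) i i = 1)}

/-- Elements of `GL_N(O_F)` reducing to the identity: `K_1 = ker red`. -/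
def K1pre : Set (MM p N) := {m | redM p N m = 1}

/-- `K = GL_N(O_F)` as a subset of `G`. -/
def Kset : Set (GG p N) := Set.range (iotaM p N)
/-- The Iwahori subgroup `I ⊆ G`. -/
def Iset : Set (GG p N) := iotaM p N '' Ipre p N
/-- The pro-p Iwahori subgroup `I_1 ⊆ G`. -/
def I1set : Set (GG p N) := iotaM p N '' I1pre p N
/-- `K_1 ⊆ G`. -/
def K1set : Set (GG p N) := iotaM p N '' K1pre p N

/-- The uniformizer `ϖ = p` as a unit of `ℚ_p`. -/
def pU : ℚ_[p]ˣ :=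
  Units.mk0 (p : ℚ_[p]) (by
    have h := (Fact.out : p.Prime).ne_zero
    exact_mod_cast Nat.cast_ne_zero.mpr h)

/-- Scalar matrices as elements of `G`. -/
def scalarGL (u : ℚ_[p]ˣ) : GG p N :=
  Units.map (algebraMap ℚ_[p] (Matrix (Fin N) (Fin N) ℚ_[p])).toMonoidHom u

/-- The central element `ϖ^n · Id`. -/
def piSc (n : ℤ) : GG p N := scalarGL p N (pU p ^ n)

/-- Invertible diagonal matrices. -/
def diagGL (d : Fin N → ℚ_[p]ˣ) : GG p N where
  val := Matrix.diagonal fun i => (d i : ℚ_[p])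
  inv := Matrix.diagonal fun i => (((d i)⁻¹ : ℚ_[p]ˣ) : ℚ_[p])
  val_inv := by
    rw [Matrix.diagonal_mul_diagonal]
    simp
  inv_val := by
    rw [Matrix.diagonal_mul_diagonal]
    simp

/-- extend `a ∈ ℤ^{N-1}` by `0` in the last coordinate. -/
def expo (a : Fin (N - 1) → ℤ) : Fin N → ℤ :=
  fun i => if h : (i : ℕ) < N - 1 then a ⟨i, h⟩ else 0

/-- `t_a = diag(ϖ^{a_1}, …, ϖ^{a_{N-1}}, 1)`. -/
def tGL (a : Fin (N - 1) → ℤ) : GG p N :=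
  diagGL p N fun i => pU p ^ (expo N a i)

/-- The permutation matrix of `σ` (with `permGL σ · e_j = e_{σ j}`, so that
`permGL` is a group homomorphism). -/
def permGL (σ : Equiv.Perm (Fin N)) : GG p N where
  val := (σ⁻¹).permMatrix ℚ_[p]
  inv := σ.permMatrix ℚ_[p]
  val_inv := by
    show ((σ⁻¹).toPEquiv.toMatrix : Matrix (Fin N) (Fin N) ℚ_[p]) * σ.toPEquiv.toMatrix = 1
    rw [← PEquiv.toMatrix_trans, ← Equiv.toPEquiv_trans]
    simp only [Equiv.self_trans_symm, Equiv.symm_trans_self, Equiv.Perm.inv_def]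
    rw [Equiv.toPEquiv_refl, PEquiv.toMatrix_refl]
  inv_val := by
    show (σ.toPEquiv.toMatrix : Matrix (Fin N) (Fin N) ℚ_[p]) * (σ⁻¹).toPEquiv.toMatrix = 1
    rw [← PEquiv.toMatrix_trans, ← Equiv.toPEquiv_trans]
    simp only [Equiv.self_trans_symm, Equiv.symm_trans_self, Equiv.Perm.inv_def]
    rw [Equiv.toPEquiv_refl, PEquiv.toMatrix_refl]

/-- `ω t_a`. -/
def wS (σ : Equiv.Perm (Fin N)) (a : Fin (N - 1) → ℤ) : GG p N :=
  permGL p N σ * tGL p N a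

/-- The permutation `ω₂` (as a matrix: first row block `(0, I_{N-1})`, last row `(1,0,…,0)`). -/
def w2 : Equiv.Perm (Fin N) := (finRotate N)⁻¹

/-- `γ = ω₂ · diag(ϖ, I_{N-1})`. -/
def gammaGL : GG p N :=
  permGL p N (w2 N) * tGL p N fun i => if (i : ℕ) = 0 then 1 else 0

/-- `S_ω = {a ∈ ℤ^{N-1} : (ω t_a) I (ω t_a)⁻¹ ∩ K ⊆ I}`. -/
def Sset (σ : Equiv.Perm (Fin N)) : Set (Fin (N - 1) → ℤ) :=
  {a | ∀ g ∈ Iset p N,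
    wS p N σ a * g * (wS p N σ a)⁻¹ ∈ Kset p N →
    wS p N σ a * g * (wS p N σ a)⁻¹ ∈ Iset p N}

/-- The unit of `k_F^×` attached to a nonzero element of `k_F` (junk value `1` at `0`). -/
def unitOf (x : ZMod p) : (ZMod p)ˣ :=
  if h : x = 0 then 1 else Units.mk0 x h

/-- The diagonal of the reduction of `m`, as an `N`-tuple of units of `k_F`. -/
def diagOf (m : MM p N) : Fin N → (ZMod p)ˣ :=
  fun i => unitOf p ((redM p N m : Matrix (Fin N) (Fin N) (ZMod p)) i i)

/-- The transformation rule for functions in `H_{IZ}(χ)`, where the character `χ` of `I`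
is given by the character `ξ` of the torus `(k_F^×)^N` through the diagonal of the
reduction, extended to `IZ` by `χ(ϖ) = 1`. -/
def HTransf (ξ : (Fin N → (ZMod p)ˣ) →* (kb p)ˣ) (φ : GG p N → kb p) : Prop :=
  ∀ (n₁ n₂ : ℤ) (m₁ m₂ : MM p N), m₁ ∈ Ipre p N → m₂ ∈ Ipre p N → ∀ g : GG p N,
    φ (piSc p N n₁ * iotaM p N m₁ * g * (piSc p N n₂ * iotaM p N m₂)) =
      (ξ (diagOf p N m₁) : kb p) * (ξ (diagOf p N m₂) : kb p) * φ g

/-- `φ` is supported on the double coset `IZ x I`. -/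
def SuppDouble (φ : GG p N → kb p) (x : GG p N) : Prop :=
  ∀ g : GG p N, φ g ≠ 0 → ∃ (n : ℤ) (m₁ m₂ : MM p N), m₁ ∈ Ipre p N ∧ m₂ ∈ Ipre p N ∧
    g = piSc p N n * iotaM p N m₁ * x * iotaM p N m₂

/-- Membership in `H_{IZ}(χ)`: the transformation rule together with support in
finitely many double cosets `IZ g I`. -/
def HMem (ξ : (Fin N → (ZMod p)ˣ) →* (kb p)ˣ) (φ : GG p N → kb p) : Prop :=
  HTransf p N ξ φ ∧
  ∃ S : Finset (GG p N), ∀ g : GG p N, φ g ≠ 0 →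
    ∃ s ∈ S, ∃ (n : ℤ) (m₁ m₂ : MM p N), m₁ ∈ Ipre p N ∧ m₂ ∈ Ipre p N ∧
      g = piSc p N n * iotaM p N m₁ * s * iotaM p N m₂

section Rep

variable {V : Type} [AddCommGroup V] [Module (kb p) V]

/-- `σ` (here `ρ`) is irreducible. -/
def IsIrred (ρ : Representation (kb p) (Gk p N) V) : Prop :=
  (∃ v : V, v ≠ 0) ∧
  ∀ W : Submodule (kb p) V, (∀ g v, v ∈ W → ρ g v ∈ W) → W = ⊥ ∨ W = ⊤

/-- Membership in the compact induction `ind_{KZ}^G σ`: left `KZ`-equivariance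
(where `ϖ` acts trivially), support in finitely many cosets `KZ g`, and smoothness. -/
def IndMem (ρ : Representation (kb p) (Gk p N) V) (f : GG p N → V) : Prop :=
  (∀ (n : ℤ) (m : MM p N) (g : GG p N),
      f (piSc p N n * iotaM p N m * g) = ρ (redM p N m) (f g)) ∧
  (∃ S : Finset (GG p N), ∀ g : GG p N, f g ≠ 0 →
      ∃ s ∈ S, ∃ (n : ℤ) (m : MM p N), g = piSc p N n * iotaM p N m * s) ∧
  (∃ U : Subgroup (GG p N), IsOpen (U : Set (GG p N)) ∧ ∀ u ∈ U, ∀ g, f (g * u) = f g)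

/-- `f` is invariant under right translation by `I_1`. -/
def IsI1Inv (f : GG p N → V) : Prop :=
  ∀ u ∈ I1set p N, ∀ g, f (g * u) = f g

/-- The defining property of the standard function `f_{ω,a}`: an `I_1`-invariant member of
`ind_{KZ}^G σ` supported on `KZ t_a I_1` with value `v₀` at `ω t_a`. -/
def IsStd (ρ : Representation (kb p) (Gk p N) V) (v₀ : V)
    (σp : Equiv.Perm (Fin N)) (a : Fin (N - 1) → ℤ) (f : GG p N → V) : Prop :=
  IndMem p N ρ f ∧ IsI1Inv p N f ∧
  (∀ g : GG p N, f g ≠ 0 → ∃ (n : ℤ) (m : MM p N) (u : GG p N), u ∈ I1set p N ∧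
      g = piSc p N n * iotaM p N m * tGL p N a * u) ∧
  f (wS p N σp a) = v₀

/-- `R` is a set of representatives for `I_1/(I_1 ∩ g⁻¹ I_1 g)`. -/
def IsRepSet (g : GG p N) (R : Finset (GG p N)) : Prop :=
  (↑R ⊆ I1set p N) ∧
  ∀ x ∈ I1set p N, ∃! r : GG p N, r ∈ R ∧
    (r⁻¹ * x ∈ I1set p N ∧ g * (r⁻¹ * x) * g⁻¹ ∈ I1set p N)

/-- The Hecke operator: `f|T_g = ∑_{r} (r g⁻¹)·f`, where `(h·f)(x) = f(xh)`. -/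
def hk (g : GG p N) (R : Finset (GG p N)) (f : GG p N → V) : GG p N → V :=
  fun x => ∑ r ∈ R, f (x * r * g⁻¹)

end Rep

section MatrixGroups

variable {N : ℕ} {R : Type*} [CommRing R]

/-- The permutation matrices, as a homomorphism to `GL_N(R)`. -/
def permHom (N : ℕ) (R : Type*) [CommRing R] : Equiv.Perm (Fin N) →* GL (Fin N) R :=
  MonoidHom.toHomUnits
    { toFun := fun σ => Matrix.of fun i j => if i = σ j then 1 else 0
      map_one' := by
        ext i j
        rw [Matrix.of_apply, Matrix.one_apply, Equiv.Perm.one_apply]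
      map_mul' := fun σ τ => by
        ext i j
        rw [Matrix.mul_apply, Finset.sum_eq_single (τ j)]
        · rw [Matrix.of_apply, Matrix.of_apply, Matrix.of_apply, if_pos rfl, mul_one,
            Equiv.Perm.mul_apply]
        · intro b _ hb
          rw [Matrix.of_apply, Matrix.of_apply, if_neg hb, mul_zero]
        · simp }

theorem permHom_apply (σ : Equiv.Perm (Fin N)) (i j : Fin N) :
    (permHom N R σ : Matrix (Fin N) (Fin N) R) i j = if i = σ j then 1 else 0 := rfl

theorem permHom_mul_apply (σ : Equiv.Perm (Fin N)) (M : Matrix (Fin N) (Fin N) R) (i j : Fin N) :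
    ((permHom N R σ : Matrix (Fin N) (Fin N) R) * M) i j = M (σ⁻¹ i) j := by
  simp only [Matrix.mul_apply, permHom_apply, ite_mul, one_mul, zero_mul]
  rw [Finset.sum_eq_single (σ⁻¹ i)]
  · simp
  · intro b _ hb
    rw [if_neg]
    rintro rfl
    simp at hb
  · simp

theorem mul_permHom_apply (σ : Equiv.Perm (Fin N)) (M : Matrix (Fin N) (Fin N) R) (i j : Fin N) :
    (M * (permHom N R σ : Matrix (Fin N) (Fin N) R)) i j = M i (σ j) := by
  simp [Matrix.mul_apply, permHom_apply]

theorem permHom_conj_apply (σ : Equiv.Perm (Fin N)) (g : GL (Fin N) R) (i j : Fin N) :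
    ((permHom N R σ * g * (permHom N R σ)⁻¹ : GL (Fin N) R) : Matrix (Fin N) (Fin N) R) i j =
      g (σ⁻¹ i) (σ⁻¹ j) := by
  rw [← map_inv, Units.val_mul, mul_permHom_apply, Units.val_mul, permHom_mul_apply]

/-- The elementary matrix `1 + c E_{ij}` as an element of `GL_N(R)`. -/
def elemGL (i j : Fin N) (h : i ≠ j) (c : R) : GL (Fin N) R where
  val := transvection i j c
  inv := transvection i j (-c)
  val_inv := by rw [transvection_mul_transvection_same i j h, add_neg_cancel, transvection_zero]
  inv_val := by rw [transvection_mul_transvection_same i j h, neg_add_cancel, transvection_zero]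

theorem elemGL_apply (i j : Fin N) (h : i ≠ j) (c : R) (a b : Fin N) :
    (elemGL i j h c : Matrix (Fin N) (Fin N) R) a b =
      (if a = b then 1 else 0) + if a = i ∧ b = j then c else 0 := by
  simp [elemGL, transvection, Matrix.one_apply, Matrix.single_apply, eq_comm]

theorem elemGL_mul_apply (i j : Fin N) (h : i ≠ j) (c : R) (M : Matrix (Fin N) (Fin N) R)
    (a b : Fin N) :
    ((elemGL i j h c : Matrix (Fin N) (Fin N) R) * M) a b =
      M a b + if a = i then c * M j b else 0 := by
  split_ifs with ha
  · subst ha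
    exact transvection_mul_apply_same _ _ _ _ _
  · rw [add_zero]
    exact transvection_mul_apply_of_ne _ _ _ _ ha _ _

theorem mul_elemGL_apply (i j : Fin N) (h : i ≠ j) (c : R) (M : Matrix (Fin N) (Fin N) R)
    (a b : Fin N) :
    (M * (elemGL i j h c : Matrix (Fin N) (Fin N) R)) a b =
      M a b + if b = j then c * M a i else 0 := by
  split_ifs with ha
  · subst ha
    exact mul_transvection_apply_same _ _ _ _ _
  · rw [add_zero]
    exact mul_transvection_apply_of_ne _ _ _ _ ha _ _

theorem elemGL_zero (i j : Fin N) (h : i ≠ j) : elemGL i j h (0 : R) = 1 :=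
  Units.ext (transvection_zero i j)

theorem elemGL_mul_elemGL (i j : Fin N) (h : i ≠ j) (c d : R) :
    elemGL i j h c * elemGL i j h d = elemGL i j h (c + d) :=
  Units.ext (transvection_mul_transvection_same i j h c d)

theorem permHom_conj_elemGL (σ : Equiv.Perm (Fin N)) (i j : Fin N) (h : i ≠ j) (c : R) :
    permHom N R σ * elemGL i j h c * (permHom N R σ)⁻¹ =
      elemGL (σ i) (σ j) (σ.injective.ne h) c := by
  refine Matrix.GeneralLinearGroup.ext fun a b => ?_
  rw [permHom_conj_apply, elemGL_apply, elemGL_apply]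
  simp only [EmbeddingLike.apply_eq_iff_eq, Equiv.Perm.inv_eq_iff_eq]

/-- Diagonal matrices, as a homomorphism to `GL_N(R)`. -/
def diagHom (N : ℕ) (R : Type*) [CommRing R] : (Fin N → Rˣ) →* GL (Fin N) R :=
  MonoidHom.toHomUnits
    { toFun := fun d => Matrix.diagonal fun i => (d i : R)
      map_one' := by simp
      map_mul' := fun d e => by simp [Matrix.diagonal_mul_diagonal] }

theorem diagHom_val (d : Fin N → Rˣ) :
    (diagHom N R d : Matrix (Fin N) (Fin N) R) = Matrix.diagonal fun i => (d i : R) := rfl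

theorem diagHom_mul_apply (d : Fin N → Rˣ) (M : Matrix (Fin N) (Fin N) R) (i j : Fin N) :
    ((diagHom N R d : Matrix (Fin N) (Fin N) R) * M) i j = d i * M i j := by
  rw [diagHom_val, Matrix.diagonal_mul]

theorem mul_diagHom_apply (d : Fin N → Rˣ) (M : Matrix (Fin N) (Fin N) R) (i j : Fin N) :
    (M * (diagHom N R d : Matrix (Fin N) (Fin N) R)) i j = M i j * d j := by
  rw [diagHom_val, Matrix.mul_diagonal]

theorem diagHom_conj_apply (d : Fin N → Rˣ) (g : GL (Fin N) R) (i j : Fin N) :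
    ((diagHom N R d * g * (diagHom N R d)⁻¹ : GL (Fin N) R) : Matrix (Fin N) (Fin N) R) i j =
      d i * g i j * ((d j)⁻¹ : Rˣ) := by
  rw [← map_inv, Units.val_mul, mul_diagHom_apply, Units.val_mul, diagHom_mul_apply, Pi.inv_apply]

theorem permHom_conj_diagHom (σ : Equiv.Perm (Fin N)) (d : Fin N → Rˣ) :
    permHom N R σ * diagHom N R d * (permHom N R σ)⁻¹ = diagHom N R (d ∘ ⇑σ⁻¹) := by
  refine Matrix.GeneralLinearGroup.ext fun a b => ?_
  rw [permHom_conj_apply, diagHom_val, diagHom_val]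
  simp [Matrix.diagonal_apply]

/-- The big cell identity in the `(i, j)`-embedded `GL_2`. -/
theorem elemGL_swap_decomp (i j : Fin N) (h : i ≠ j) (t : Rˣ) :
    elemGL j i h.symm (t : R) = elemGL i j h ((t⁻¹ : Rˣ) : R) * permHom N R (Equiv.swap i j) *
      diagHom N R (fun a => if a = i then t else if a = j then -t⁻¹ else 1) *
        elemGL i j h ((t⁻¹ : Rˣ) : R) := by
  have h' := h.symm
  refine Matrix.GeneralLinearGroup.ext fun a b => ?_
  rw [mul_assoc, mul_assoc, Units.val_mul, elemGL_mul_apply, Units.val_mul, permHom_mul_apply,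
    permHom_mul_apply, Units.val_mul, diagHom_mul_apply, diagHom_mul_apply, elemGL_apply,
    elemGL_apply, elemGL_apply, Equiv.swap_inv]
  rcases eq_or_ne a i with rfl | hai
  · rcases eq_or_ne b a with rfl | hba
    · simp [h, h']
    · rcases eq_or_ne b j with rfl | hbj
      · simp [h, h']
      · simp [h, h', hba, hbj, hba.symm, hbj.symm]
  · rcases eq_or_ne a j with rfl | haj
    · rcases eq_or_ne b i with rfl | hba
      · simp [h, h']
      · rcases eq_or_ne b a with rfl | hbj
        · simp [h, h']
        · simp [h', hba, hbj, hba.symm, hbj.symm]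
    · simp [hai, haj, Equiv.swap_apply_of_ne_of_ne hai haj]

end MatrixGroups

section UnipotentGroups

/-- The elements of `GL_N` over a finite ring which are unipotent for the strict order `r`. -/
def unip (N : ℕ) (R : Type*) [CommRing R] [Finite R] (r : Fin N → Fin N → Prop)
    [IsStrictOrder (Fin N) r] : Subgroup (GL (Fin N) R) :=
  let S : Submonoid (GL (Fin N) R) :=
    { carrier := {g | (∀ a, (g : Matrix (Fin N) (Fin N) R) a a = 1) ∧
        ∀ a b, a ≠ b → ¬ r a b → (g : Matrix (Fin N) (Fin N) R) a b = 0}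
      one_mem' := ⟨fun a => by simp, fun a b hab _ => by simp [hab]⟩
      mul_mem' := by
        rintro g h ⟨hg1, hg2⟩ ⟨hh1, hh2⟩
        refine ⟨fun a => ?_, fun a b hab hr => ?_⟩
        · rw [Units.val_mul, Matrix.mul_apply, Finset.sum_eq_single a, hg1, hh1, one_mul]
          · intro c _ hc
            by_cases h1 : r a c
            · rw [hh2 c a hc (asymm h1), mul_zero]
            · rw [hg2 a c hc.symm h1, zero_mul]
          · simp
        · rw [Units.val_mul, Matrix.mul_apply]
          refine Finset.sum_eq_zero fun c _ => ?_
          rcases eq_or_ne a c with rfl | hac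
          · rw [hh2 _ _ hab hr, mul_zero]
          · rcases eq_or_ne c b with rfl | hcb
            · rw [hg2 _ _ hab hr, zero_mul]
            · by_cases h1 : r a c
              · rw [hh2 c b hcb fun h2 => hr (_root_.trans h1 h2), mul_zero]
              · rw [hg2 a c hac h1, zero_mul] }
  { S with
    inv_mem' := by
      intro g hg
      have h1 : g⁻¹ = g ^ (Nat.card (GL (Fin N) R) - 1) := by
        rw [inv_eq_iff_mul_eq_one, ← pow_succ', Nat.sub_add_cancel Nat.card_pos, pow_card_eq_one']
      rw [h1]
      exact S.pow_mem hg _ }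

variable {N : ℕ} {R : Type*} [CommRing R] [Finite R] {r : Fin N → Fin N → Prop}
  [IsStrictOrder (Fin N) r]

theorem mem_unip {g : GL (Fin N) R} : g ∈ unip N R r ↔
    (∀ a, (g : Matrix (Fin N) (Fin N) R) a a = 1) ∧
      ∀ a b, a ≠ b → ¬ r a b → (g : Matrix (Fin N) (Fin N) R) a b = 0 := Iff.rfl

theorem elemGL_mem_unip (i j : Fin N) (h : i ≠ j) (hr : r i j) (c : R) :
    elemGL i j h c ∈ unip N R r := by
  refine mem_unip.2 ⟨fun a => ?_, fun a b hab hnr => ?_⟩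
  · rw [elemGL_apply, if_pos rfl, if_neg, add_zero]
    rintro ⟨rfl, rfl⟩
    exact h rfl
  · rw [elemGL_apply, if_neg hab, if_neg, add_zero]
    rintro ⟨rfl, rfl⟩
    exact hnr hr

theorem permHom_conj_mem_unip {r' : Fin N → Fin N → Prop} [IsStrictOrder (Fin N) r']
    (σ : Equiv.Perm (Fin N)) {g : GL (Fin N) R} (hg : g ∈ unip N R r)
    (h : ∀ a b, (g : Matrix (Fin N) (Fin N) R) a b ≠ 0 → r a b → r' (σ a) (σ b)) :
    permHom N R σ * g * (permHom N R σ)⁻¹ ∈ unip N R r' := by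
  refine mem_unip.2 ⟨fun a => ?_, fun a b hab hr => ?_⟩
  · rw [permHom_conj_apply, (mem_unip.1 hg).1]
  · rw [permHom_conj_apply]
    by_contra h0
    have hne : σ⁻¹ a ≠ σ⁻¹ b := (σ⁻¹).injective.ne hab
    by_cases h1 : r (σ⁻¹ a) (σ⁻¹ b)
    · exact hr (by simpa using h _ _ h0 h1)
    · exact h0 ((mem_unip.1 hg).2 _ _ hne h1)

theorem diagHom_conj_mem_unip (d : Fin N → Rˣ) {g : GL (Fin N) R} (hg : g ∈ unip N R r) :
    diagHom N R d * g * (diagHom N R d)⁻¹ ∈ unip N R r := by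
  refine mem_unip.2 ⟨fun a => ?_, fun a b hab hr => ?_⟩
  · rw [diagHom_conj_apply, (mem_unip.1 hg).1, mul_one, Units.mul_inv]
  · rw [diagHom_conj_apply, (mem_unip.1 hg).2 a b hab hr, mul_zero, zero_mul]

end UnipotentGroups

section SimpleReflections

variable {n : ℕ} {R : Type*} [CommRing R]

/-- The simple reflection exchanging `i` and `i + 1`. -/
abbrev simpleSwap (i : Fin n) : Equiv.Perm (Fin (n + 1)) := Equiv.swap i.castSucc i.succ

/-- The permutation matrix of a simple reflection. -/
abbrev simplePerm (R : Type*) [CommRing R] (i : Fin n) : GL (Fin (n + 1)) R :=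
  permHom (n + 1) R (simpleSwap i)

/-- The one-parameter subgroup of a simple root. -/
abbrev posElem (i : Fin n) (t : R) : GL (Fin (n + 1)) R :=
  elemGL i.castSucc i.succ (Fin.castSucc_lt_succ (i := i)).ne t

/-- The one-parameter subgroup of the negative of a simple root. -/
abbrev negElem (i : Fin n) (t : R) : GL (Fin (n + 1)) R :=
  elemGL i.succ i.castSucc (Fin.castSucc_lt_succ (i := i)).ne' t

theorem simplePerm_mul_self (i : Fin n) : simplePerm R i * simplePerm R i = 1 := by
  rw [← map_mul, Equiv.swap_mul_self, map_one]

theorem simplePerm_inv (i : Fin n) : (simplePerm R i)⁻¹ = simplePerm R i :=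
  inv_eq_of_mul_eq_one_left (simplePerm_mul_self i)

theorem simplePerm_mul_mul (i : Fin n) (g : GL (Fin (n + 1)) R) :
    simplePerm R i * (simplePerm R i * g) = g := by
  rw [← mul_assoc, simplePerm_mul_self, one_mul]

theorem simplePerm_conj_posElem (i : Fin n) (t : R) :
    simplePerm R i * posElem i t * simplePerm R i = negElem i t := by
  conv_lhs => rw [← simplePerm_inv (R := R) i, simplePerm_inv (R := R) i]
  rw [← simplePerm_inv i]
  nth_rw 1 [simplePerm_inv i]
  rw [permHom_conj_elemGL]
  simp

theorem simpleSwap_lt {i : Fin n} {a b : Fin (n + 1)} (h : a < b)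
    (hne : ¬ (a = i.castSucc ∧ b = i.succ)) : simpleSwap i a < simpleSwap i b := by
  simp only [Equiv.swap_apply_def, Fin.ext_iff, Fin.lt_def, Fin.val_castSucc, Fin.val_succ] at *
  split_ifs <;> simp_all <;> omega

/-- The order on indices whose unipotent group is `U ∩ w U⁻ w⁻¹`. -/
def invRel (w : Equiv.Perm (Fin n)) (a b : Fin n) : Prop := a < b ∧ w⁻¹ b < w⁻¹ a

instance (w : Equiv.Perm (Fin n)) : IsStrictOrder (Fin n) (invRel w) where
  irrefl _ h := lt_irrefl _ h.1
  trans _ _ _ h h' := ⟨h.1.trans h'.1, h'.2.trans h.2⟩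

end SimpleReflections

section WeightVectors

variable {p n : ℕ} [Fact p.Prime] {K : Type*} [Field K] {V : Type*} [AddCommGroup V] [Module K V]
  (ρ : Representation K (Gk p (n + 1)) V)

theorem rep_mul_apply (g h : Gk p (n + 1)) (v : V) : ρ (g * h) v = ρ g (ρ h v) := by
  rw [map_mul, Module.End.mul_apply]

/-- `v` is fixed by the upper triangular unipotent matrices and spans a torus-stable line. -/
def IsBorelEigen (v : V) : Prop :=
  (∀ u ∈ unip (n + 1) (ZMod p) (· < ·), ρ u v = v) ∧
    ∀ d, ∃ c : K, ρ (diagHom (n + 1) (ZMod p) d) v = c • v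

/-- The Hecke operator of a simple reflection on vectors fixed by the upper triangular
unipotent matrices. -/
def simpleHecke (i : Fin n) (v : V) : V :=
  ∑ t : ZMod p, ρ (posElem i t * simplePerm (ZMod p) i) v

open Classical in
/-- The Hecke operator of a permutation on vectors fixed by the upper triangular
unipotent matrices. -/
def permHecke (w : Equiv.Perm (Fin (n + 1))) (v : V) : V :=
  ∑ u : Gk p (n + 1) with u ∈ unip (n + 1) (ZMod p) (invRel w),
    ρ (u * permHom (n + 1) (ZMod p) w) v

variable {ρ}

theorem simpleHecke_fixed {v : V} (hv : ∀ u ∈ unip (n + 1) (ZMod p) (· < ·), ρ u v = v)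
    (i : Fin n) {u : Gk p (n + 1)} (hu : u ∈ unip (n + 1) (ZMod p) (· < ·)) :
    ρ u (simpleHecke ρ i v) = simpleHecke ρ i v := by
  set c : ZMod p := (u : Matrix (Fin (n + 1)) (Fin (n + 1)) (ZMod p)) i.castSucc i.succ with hc
  have hlt := Fin.castSucc_lt_succ (i := i)
  rw [simpleHecke, map_sum]
  refine Fintype.sum_equiv (Equiv.addRight c) _ _ fun t => ?_
  have hy : posElem i (-(t + c)) * (u * posElem i t) ∈ unip (n + 1) (ZMod p) (· < ·) :=
    mul_mem (elemGL_mem_unip _ _ _ hlt _) (mul_mem hu (elemGL_mem_unip _ _ _ hlt _))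
  have hy0 : ((posElem i (-(t + c)) * (u * posElem i t) : Gk p (n + 1)) :
      Matrix (Fin (n + 1)) (Fin (n + 1)) (ZMod p)) i.castSucc i.succ = 0 := by
    rw [Units.val_mul, elemGL_mul_apply, Units.val_mul, mul_elemGL_apply, mul_elemGL_apply,
      if_pos rfl, if_pos rfl, if_pos rfl, (mem_unip.1 hu).1, (mem_unip.1 hu).1,
      (mem_unip.1 hu).2 i.succ i.castSucc hlt.ne' (not_lt.2 hlt.le), ← hc]
    ring
  have hs := permHom_conj_mem_unip (r' := (· < ·)) (simpleSwap i) hy fun a b hab hr =>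
    simpleSwap_lt hr fun hh => hab (by rw [hh.1, hh.2, hy0])
  rw [← rep_mul_apply, Equiv.coe_addRight]
  have key : u * (posElem i t * simplePerm (ZMod p) i) =
      posElem i (t + c) * simplePerm (ZMod p) i *
        (simplePerm (ZMod p) i * (posElem i (-(t + c)) * (u * posElem i t)) *
          (simplePerm (ZMod p) i)⁻¹) := by
    rw [simplePerm_inv, mul_assoc (posElem i (t + c)), mul_assoc (simplePerm (ZMod p) i),
      simplePerm_mul_mul, mul_assoc (posElem i _), ← mul_assoc (posElem i _) (posElem i _),
      elemGL_mul_elemGL, add_neg_cancel, elemGL_zero, one_mul, mul_assoc]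
  rw [key, rep_mul_apply, hv _ hs]

theorem IsBorelEigen.simpleHecke {v : V} (hv : IsBorelEigen ρ v) (i : Fin n) :
    IsBorelEigen ρ (simpleHecke ρ i v) := by
  refine ⟨fun u hu => simpleHecke_fixed hv.1 i hu, fun d => ?_⟩
  obtain ⟨c, hc⟩ := hv.2 (d ∘ ⇑(simpleSwap i)⁻¹)
  refine ⟨c, ?_⟩
  rw [IH.simpleHecke, map_sum, Finset.smul_sum]
  refine Fintype.sum_equiv (Units.mulLeft (d i.castSucc * (d i.succ)⁻¹)) _ _ fun t => ?_
  rw [← rep_mul_apply, ← map_smul, ← hc, ← rep_mul_apply]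
  congr 2
  rw [← permHom_conj_diagHom, simplePerm_inv, mul_assoc, mul_assoc, simplePerm_mul_mul,
    ← mul_assoc, ← mul_assoc]
  congr 1
  refine Matrix.GeneralLinearGroup.ext fun a b => ?_
  rw [Units.val_mul, Units.val_mul, diagHom_mul_apply, mul_diagHom_apply, elemGL_apply,
    elemGL_apply, Units.mulLeft_apply]
  rcases eq_or_ne a b with rfl | hab
  · have : ¬ (a = i.castSucc ∧ a = i.succ) := by
      rintro ⟨rfl, h⟩
      exact (Fin.castSucc_lt_succ (i := i)).ne h
    simp [this]
  · rw [if_neg hab]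
    split_ifs with h
    · rw [h.1, h.2]
      simp only [zero_add, Units.val_mul]
      linear_combination (-(d i.castSucc : ZMod p) * t) * Units.inv_mul (d i.succ)
    · simp

theorem simpleHecke_simpleHecke [CharP K p] {v : V} (hv : IsBorelEigen ρ v) (i : Fin n) :
    ∃ c : K, simpleHecke ρ i (simpleHecke ρ i v) = c • simpleHecke ρ i v := by
  have hlt := Fin.castSucc_lt_succ (i := i)
  have key : ∀ t : ZMod p, ∃ c : K,
      ∑ t' : ZMod p, ρ (posElem i t') (ρ (negElem i t) v) = c • simpleHecke ρ i v := by
    intro t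
    by_cases ht : t = 0
    · refine ⟨0, ?_⟩
      subst ht
      have h : ∀ t' : ZMod p, ρ (posElem i t') (ρ (negElem i 0) v) = v := fun t' => by
        rw [negElem, elemGL_zero, map_one, Module.End.one_apply, hv.1 _ (elemGL_mem_unip _ _ _ hlt _)]
      rw [Finset.sum_congr rfl fun t' _ => h t', Finset.sum_const, Finset.card_univ, ZMod.card,
        ← Nat.cast_smul_eq_nsmul K, CharP.cast_eq_zero, zero_smul, zero_smul]
    · lift t to (ZMod p)ˣ using IsUnit.mk0 t ht
      obtain ⟨c, hc⟩ := hv.2 (fun a => if a = i.castSucc then t else if a = i.succ then -t⁻¹ else 1)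
      refine ⟨c, ?_⟩
      rw [simpleHecke, Finset.smul_sum]
      refine Fintype.sum_equiv (Equiv.addRight ((t⁻¹ : (ZMod p)ˣ) : ZMod p)) _ _ fun t' => ?_
      rw [negElem, elemGL_swap_decomp _ _ hlt.ne, rep_mul_apply, hv.1 _ (elemGL_mem_unip _ _ _ hlt _),
        rep_mul_apply, hc, map_smul, map_smul, ← rep_mul_apply, ← mul_assoc, elemGL_mul_elemGL,
        Equiv.coe_addRight]
  choose c hc using key
  refine ⟨∑ t, c t, ?_⟩
  rw [Finset.sum_smul, Finset.sum_congr rfl fun t _ => (hc t).symm, Finset.sum_comm]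
  rw [simpleHecke]
  refine Finset.sum_congr rfl fun t' _ => ?_
  rw [simpleHecke, map_sum]
  refine Finset.sum_congr rfl fun t _ => ?_
  rw [← rep_mul_apply, ← rep_mul_apply, mul_assoc (posElem i t'), ← mul_assoc (simplePerm _ i),
    simplePerm_conj_posElem]

end WeightVectors

section WeightVectorExistence

variable {p n : ℕ} [Fact p.Prime] {K : Type*} [Field K] {V : Type*} [AddCommGroup V] [Module K V]
  {ρ : Representation K (Gk p (n + 1)) V}

theorem permHecke_simpleSwap_mul {w : Equiv.Perm (Fin (n + 1))} {i : Fin n}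
    (hw : w⁻¹ i.castSucc < w⁻¹ i.succ) (v : V) :
    permHecke ρ (simpleSwap i * w) v = simpleHecke ρ i (permHecke ρ w v) := by
  classical
  have hlt := Fin.castSucc_lt_succ (i := i)
  have hrel : ∀ a b, simpleSwap i a < simpleSwap i b → w⁻¹ b < w⁻¹ a →
      invRel (simpleSwap i * w) (simpleSwap i a) (simpleSwap i b) := fun a b h1 h2 => by
    refine ⟨h1, ?_⟩
    simpa [_root_.mul_inv_rev] using h2
  have hrel' : ∀ a b, simpleSwap i a < simpleSwap i b → invRel (simpleSwap i * w) a b →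
      invRel w (simpleSwap i a) (simpleSwap i b) := fun a b h1 h2 => by
    refine ⟨h1, ?_⟩
    simpa [_root_.mul_inv_rev] using h2.2
  have hroot : invRel (simpleSwap i * w) i.castSucc i.succ := by
    refine ⟨hlt, ?_⟩
    simpa [_root_.mul_inv_rev] using hw
  rw [permHecke, permHecke, simpleHecke]
  simp_rw [map_sum, ← rep_mul_apply]
  rw [← Finset.sum_product']
  symm
  refine Finset.sum_nbij'
    (fun x => posElem i x.1 * (simplePerm (ZMod p) i * x.2 * (simplePerm (ZMod p) i)⁻¹))
    (fun u => ((u : Matrix (Fin (n + 1)) (Fin (n + 1)) (ZMod p)) i.castSucc i.succ,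
      simplePerm (ZMod p) i * (posElem i (-(u : Matrix (Fin (n + 1)) (Fin (n + 1)) (ZMod p))
        i.castSucc i.succ) * u) * (simplePerm (ZMod p) i)⁻¹)) ?_ ?_ ?_ ?_ ?_
  · rintro ⟨t, u⟩ hu
    simp only [Finset.mem_product, Finset.mem_univ, true_and, Finset.mem_filter] at hu ⊢
    refine mul_mem (elemGL_mem_unip _ _ _ hroot _) (permHom_conj_mem_unip _ hu fun a b _ hr => ?_)
    refine hrel a b (simpleSwap_lt hr.1 ?_) hr.2
    rintro ⟨rfl, rfl⟩
    exact hw.not_gt hr.2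
  · intro u hu
    simp only [Finset.mem_product, Finset.mem_univ, true_and, Finset.mem_filter] at hu ⊢
    refine permHom_conj_mem_unip _ (mul_mem (elemGL_mem_unip _ _ _ hroot _) hu)
      fun a b hab hr => hrel' a b (simpleSwap_lt hr.1 ?_) hr
    rintro ⟨rfl, rfl⟩
    refine hab ?_
    rw [Units.val_mul, elemGL_mul_apply, if_pos rfl, (mem_unip.1 hu).1, mul_one, add_neg_cancel]
  · rintro ⟨t, u⟩ hu
    simp only [Finset.mem_product, Finset.mem_univ, true_and, Finset.mem_filter] at hu
    have h1 : ((posElem i t * (simplePerm (ZMod p) i * u * (simplePerm (ZMod p) i)⁻¹) :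
        Gk p (n + 1)) : Matrix (Fin (n + 1)) (Fin (n + 1)) (ZMod p)) i.castSucc i.succ = t := by
      rw [Units.val_mul, elemGL_mul_apply, if_pos rfl, permHom_conj_apply, permHom_conj_apply,
        (mem_unip.1 hu).1, mul_one, (mem_unip.1 hu).2, zero_add]
      · simpa using hlt.ne'
      · intro h
        have h2 := h.1
        rw [Equiv.swap_inv, Equiv.swap_apply_left, Equiv.swap_apply_right] at h2
        exact h2.asymm hlt
    simp only [h1]
    rw [← mul_assoc (posElem i _), elemGL_mul_elemGL, neg_add_cancel, elemGL_zero, one_mul,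
      simplePerm_inv]
    simp only [mul_assoc, simplePerm_mul_mul, simplePerm_mul_self, mul_one]
  · intro u hu
    simp only
    rw [simplePerm_inv]
    simp only [mul_assoc, simplePerm_mul_mul, simplePerm_mul_self, mul_one]
    rw [← mul_assoc, elemGL_mul_elemGL, add_neg_cancel, elemGL_zero, one_mul]
  · rintro ⟨t, u⟩ hu
    simp only
    congr 2
    rw [simplePerm_inv, map_mul]
    simp only [mul_assoc, simplePerm_mul_mul]

theorem permHecke_one (v : V) : permHecke ρ 1 v = v := by
  classical
  rw [permHecke, Finset.sum_eq_single 1]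
  · simp
  · intro u hu hne
    exfalso
    apply hne
    simp only [Finset.mem_filter, Finset.mem_univ, true_and] at hu
    refine Matrix.GeneralLinearGroup.ext fun a b => ?_
    rw [Units.val_one, Matrix.one_apply]
    split_ifs with h
    · rw [h, (mem_unip.1 hu).1]
    · exact (mem_unip.1 hu).2 a b h fun h' => h'.1.asymm (by simpa using h'.2)
  · intro h
    simp at h

/-- A strictly increasing function of the Bruhat length of `w` along simple reflections. -/
def lengthWeight (w : Equiv.Perm (Fin (n + 1))) : ℕ := ∑ a : Fin (n + 1), a * (w⁻¹ a).rev

theorem lengthWeight_lt {w : Equiv.Perm (Fin (n + 1))} {i : Fin n}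
    (hw : w⁻¹ i.castSucc < w⁻¹ i.succ) : lengthWeight w < lengthWeight (simpleSwap i * w) := by
  have hlt := Fin.castSucc_lt_succ (i := i)
  have h1 : lengthWeight (simpleSwap i * w) =
      ∑ a : Fin (n + 1), (simpleSwap i a : ℕ) * (w⁻¹ a).rev := by
    rw [lengthWeight]
    refine Fintype.sum_equiv (simpleSwap i) _ _ fun a => ?_
    simp [_root_.mul_inv_rev]
  rw [h1, ← Int.ofNat_lt, ← sub_pos, lengthWeight]
  push_cast
  rw [← Finset.sum_sub_distrib, Fintype.sum_eq_add i.castSucc i.succ hlt.ne]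
  · have h2 := (w⁻¹ i.succ).isLt
    have h3 : ((w⁻¹ i.castSucc : Fin (n + 1)) : ℕ) < w⁻¹ i.succ := hw
    simp only [Equiv.swap_apply_left, Equiv.swap_apply_right, Fin.val_succ, Fin.val_castSucc,
      Fin.val_rev]
    rw [Nat.add_sub_add_right, Nat.add_sub_add_right, Nat.cast_sub (by omega),
      Nat.cast_sub (by omega)]
    push_cast
    have h4 : ((w⁻¹ i.castSucc : Fin (n + 1)) : ℤ) < ((w⁻¹ i.succ : Fin (n + 1)) : ℕ) := by
      exact_mod_cast h3
    nlinarith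
  · rintro a ⟨ha, ha'⟩
    rw [Equiv.swap_apply_of_ne_of_ne ha ha', sub_self]

theorem eq_one_of_forall_lt {w : Equiv.Perm (Fin (n + 1))}
    (h : ∀ i : Fin n, w⁻¹ i.castSucc < w⁻¹ i.succ) : w = 1 := by
  have h1 : StrictMono ⇑w⁻¹ := Fin.strictMono_iff_lt_succ.2 h
  have h2 := (h1.range_inj strictMono_id).1 (by simp)
  rw [← _root_.inv_inj, inv_one]
  exact Equiv.ext fun a => congrFun h2 a

theorem IsBorelEigen.permHecke {v : V} (hv : IsBorelEigen ρ v) (w : Equiv.Perm (Fin (n + 1))) :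
    IsBorelEigen ρ (permHecke ρ w v) := by
  induction hk : lengthWeight w using Nat.strong_induction_on generalizing w with
  | _ k ih =>
    by_cases h : ∀ i : Fin n, w⁻¹ i.castSucc < w⁻¹ i.succ
    · rw [eq_one_of_forall_lt h, permHecke_one]
      exact hv
    · push Not at h
      obtain ⟨i, hi⟩ := h
      have hi' : w⁻¹ i.succ < w⁻¹ i.castSucc :=
        lt_of_le_of_ne hi ((w⁻¹).injective.ne (Fin.castSucc_lt_succ (i := i)).ne')
      have h1 : (simpleSwap i * w)⁻¹ i.castSucc < (simpleSwap i * w)⁻¹ i.succ := by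
        simpa [_root_.mul_inv_rev] using hi'
      have h2 := lengthWeight_lt h1
      have h3 := permHecke_simpleSwap_mul (ρ := ρ) h1 v
      rw [← mul_assoc, Equiv.swap_mul_self, one_mul] at h2 h3
      rw [h3]
      exact (ih _ (hk ▸ h2) _ rfl).simpleHecke i

/-- A nonzero vector fixed by `U`, stable up to scalars under the torus, can be improved to an
eigenvector of all simple Hecke operators. -/
theorem IsBorelEigen.exists_heckeEigen [CharP K p] {v : V} (hv : IsBorelEigen ρ v) (hv0 : v ≠ 0) :
    ∃ m : V, m ≠ 0 ∧ IsBorelEigen ρ m ∧ ∀ i, ∃ c : K, IH.simpleHecke ρ i m = c • m := by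
  obtain ⟨w, hw, hmax⟩ := Set.exists_max_image {w | IH.permHecke ρ w v ≠ 0} lengthWeight
    (Set.toFinite _) ⟨1, by rwa [Set.mem_ofPred_eq, permHecke_one]⟩
  refine ⟨IH.permHecke ρ w v, hw, hv.permHecke w, fun i => ?_⟩
  rcases lt_or_gt_of_ne ((w⁻¹).injective.ne (Fin.castSucc_lt_succ (i := i)).ne) with hi | hi
  · refine ⟨0, ?_⟩
    rw [zero_smul, ← permHecke_simpleSwap_mul hi]
    by_contra h
    exact (hmax _ h).not_gt (lengthWeight_lt hi)
  · have h1 : (simpleSwap i * w)⁻¹ i.castSucc < (simpleSwap i * w)⁻¹ i.succ := by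
      simpa [_root_.mul_inv_rev] using hi
    have h3 := permHecke_simpleSwap_mul (ρ := ρ) h1 v
    rw [← mul_assoc, Equiv.swap_mul_self, one_mul] at h3
    rw [h3]
    exact simpleHecke_simpleHecke (hv.permHecke _) i

end WeightVectorExistence

section Generation

variable {p n : ℕ} [Fact p.Prime] {K : Type*} [Field K] {V : Type*} [AddCommGroup V] [Module K V]
  {ρ : Representation K (Gk p (n + 1)) V}

/-- `GL_N` of a field is generated, as a monoid, by diagonal matrices, the matrices of simple
reflections and lower triangular elementary matrices. -/
theorem submonoid_eq_top (S : Submonoid (Gk p (n + 1)))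
    (hdiag : ∀ d, diagHom (n + 1) (ZMod p) d ∈ S) (hsimple : ∀ i, simplePerm (ZMod p) i ∈ S)
    (hlow : ∀ u ∈ unip (n + 1) (ZMod p) (· > ·), u ∈ S) (g : Gk p (n + 1)) : g ∈ S := by
  have hperm : ∀ w, permHom (n + 1) (ZMod p) w ∈ S := by
    have h : Submonoid.closure (Set.range fun i : Fin n => simpleSwap i) ≤
        S.comap (permHom (n + 1) (ZMod p)) := by
      rw [Submonoid.closure_le]
      rintro _ ⟨i, rfl⟩
      exact hsimple i
    rw [Equiv.Perm.mclosure_swap_castSucc_succ] at h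
    exact fun w => h (Submonoid.mem_top w)
  have helem : ∀ (i j : Fin (n + 1)) (h : i ≠ j) (c : ZMod p), elemGL i j h c ∈ S := by
    intro i j h c
    rcases lt_or_gt_of_ne h with hij | hij
    · have h1 := permHom_conj_elemGL (Equiv.swap i j) j i h.symm c
      simp only [Equiv.swap_apply_left, Equiv.swap_apply_right] at h1
      rw [← h1, ← map_inv]
      exact mul_mem (mul_mem (hperm _) (hlow _ (elemGL_mem_unip (r := (· > ·)) _ _ _ hij _))) (hperm _)
    · exact hlow _ (elemGL_mem_unip (r := (· > ·)) _ _ _ hij _)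
  have key := Matrix.diagonal_transvection_induction_of_det_ne_zero
    (fun M => ∀ g : Gk p (n + 1), (g : Matrix (Fin (n + 1)) (Fin (n + 1)) (ZMod p)) = M → g ∈ S)
    (g : Matrix (Fin (n + 1)) (Fin (n + 1)) (ZMod p))
    (Matrix.GeneralLinearGroup.det g).ne_zero ?_ ?_ ?_
  · exact key g rfl
  · intro D hD g hg
    rw [Matrix.det_diagonal, Finset.prod_ne_zero_iff] at hD
    have h1 : g = diagHom (n + 1) (ZMod p) fun i => Units.mk0 (D i) (hD i (Finset.mem_univ i)) := by
      refine Units.ext ?_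
      rw [hg, diagHom_val]
      simp
    rw [h1]
    exact hdiag _
  · rintro ⟨i, j, hij, c⟩ g hg
    have h1 : g = elemGL i j hij c := Units.ext hg
    rw [h1]
    exact helem i j hij c
  · intro A B hA hB hPA hPB g hg
    have h1 : g = Matrix.GeneralLinearGroup.mkOfDetNeZero A hA *
        Matrix.GeneralLinearGroup.mkOfDetNeZero B hB := Units.ext hg
    rw [h1]
    exact mul_mem (hPA _ rfl) (hPB _ rfl)

/-- A Hecke eigenvector generates an irreducible representation under the lower triangular
unipotent matrices. -/
theorem IsBorelEigen.span_eq_top {m : V} (hm : IsBorelEigen ρ m) (hm0 : m ≠ 0)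
    (hT : ∀ i, ∃ c : K, IH.simpleHecke ρ i m = c • m)
    (hirr : ∀ W : Submodule K V, (∀ g v, v ∈ W → ρ g v ∈ W) → W = ⊥ ∨ W = ⊤) :
    Submodule.span K ((fun u => ρ u m) '' (unip (n + 1) (ZMod p) (· > ·) : Set _)) = ⊤ := by
  set W := Submodule.span K ((fun u => ρ u m) '' (unip (n + 1) (ZMod p) (· > ·) : Set _)) with hW
  have hgen : ∀ u ∈ unip (n + 1) (ZMod p) (· > ·), ρ u m ∈ W := fun u hu =>
    Submodule.subset_span ⟨u, hu, rfl⟩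
  have hmW : m ∈ W := by simpa using hgen 1 (one_mem _)
  let S : Submonoid (Gk p (n + 1)) :=
    { carrier := {g | ∀ v ∈ W, ρ g v ∈ W}
      one_mem' := by simp
      mul_mem' := fun {g h} hg hh v hv => by
        rw [rep_mul_apply]
        exact hg _ (hh v hv) }
  have hS : ∀ g, (∀ u ∈ unip (n + 1) (ZMod p) (· > ·), ρ g (ρ u m) ∈ W) → g ∈ S := by
    intro g hg v hv
    have h1 : W ≤ W.comap (ρ g) := by
      rw [hW, Submodule.span_le]
      rintro _ ⟨u, hu, rfl⟩
      exact hg u hu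
    exact h1 hv
  have hlow : ∀ u ∈ unip (n + 1) (ZMod p) (· > ·), u ∈ S := fun u hu => hS u fun u' hu' => by
    rw [← rep_mul_apply]
    exact hgen _ (mul_mem hu hu')
  refine (hirr W fun g v hv => ?_).resolve_left fun h => hm0 ?_
  swap
  · rw [h] at hmW
    exact (Submodule.mem_bot K).1 hmW
  refine submonoid_eq_top S (fun d => hS _ fun u hu => ?_) (fun i => hS _ fun u hu => ?_) hlow g v hv
  · obtain ⟨c, hc⟩ := hm.2 d
    have h1 : diagHom (n + 1) (ZMod p) d * u = diagHom (n + 1) (ZMod p) d * u *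
      (diagHom (n + 1) (ZMod p) d)⁻¹ * diagHom (n + 1) (ZMod p) d := by group
    rw [← rep_mul_apply, h1, rep_mul_apply, hc, map_smul]
    exact W.smul_mem _ (hgen _ (diagHom_conj_mem_unip d hu))
  · have hlt := Fin.castSucc_lt_succ (i := i)
    have hne : ∀ t : ZMod p, t ≠ 0 → ρ (simplePerm (ZMod p) i * negElem i t) m ∈ W := by
      intro t ht
      lift t to (ZMod p)ˣ using IsUnit.mk0 t ht
      obtain ⟨c, hc⟩ := hm.2
        (fun a => if a = i.castSucc then t else if a = i.succ then -t⁻¹ else 1)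
      rw [negElem, elemGL_swap_decomp _ _ hlt.ne, ← mul_assoc, rep_mul_apply,
        hm.1 _ (elemGL_mem_unip _ _ _ hlt _), ← mul_assoc, rep_mul_apply, hc, map_smul,
        ← mul_assoc, simplePerm_conj_posElem]
      exact W.smul_mem _ (hgen _ (elemGL_mem_unip (r := (· > ·)) _ _ _ hlt _))
    have hall : ∀ t : ZMod p, ρ (simplePerm (ZMod p) i * negElem i t) m ∈ W := by
      intro t
      by_cases ht : t = 0
      · subst ht
        obtain ⟨c, hc⟩ := hT i
        have h1 : IH.simpleHecke ρ i m = ∑ t, ρ (simplePerm (ZMod p) i * negElem i t) m := by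
          rw [IH.simpleHecke]
          refine Finset.sum_congr rfl fun t _ => ?_
          rw [← simplePerm_conj_posElem, mul_assoc, simplePerm_mul_mul]
        rw [hc, ← Finset.add_sum_erase _ _ (Finset.mem_univ (0 : ZMod p))] at h1
        rw [← sub_eq_iff_eq_add.2 h1]
        exact W.sub_mem (W.smul_mem c hmW)
          (W.sum_mem fun t ht => hne t (Finset.ne_of_mem_erase ht))
      · exact hne t ht
    set c : ZMod p := (u : Matrix (Fin (n + 1)) (Fin (n + 1)) (ZMod p)) i.succ i.castSucc with hc
    have hy : u * negElem i (-c) ∈ unip (n + 1) (ZMod p) (· > ·) :=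
      mul_mem hu (elemGL_mem_unip (r := (· > ·)) _ _ _ hlt _)
    have hy0 : ((u * negElem i (-c) : Gk p (n + 1)) :
        Matrix (Fin (n + 1)) (Fin (n + 1)) (ZMod p)) i.succ i.castSucc = 0 := by
      rw [Units.val_mul, mul_elemGL_apply, if_pos rfl, (mem_unip.1 hu).1, ← hc, mul_one,
        add_neg_cancel]
    have hs := permHom_conj_mem_unip (r' := (· > ·)) (simpleSwap i) hy fun a b hab hr =>
      simpleSwap_lt hr fun hh => hab (by rw [hh.1, hh.2, hy0])
    have key : simplePerm (ZMod p) i * u = simplePerm (ZMod p) i * (u * negElem i (-c)) *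
        (simplePerm (ZMod p) i)⁻¹ * (simplePerm (ZMod p) i * negElem i c) := by
      rw [← mul_assoc, inv_mul_cancel_right, mul_assoc, mul_assoc u, elemGL_mul_elemGL,
        neg_add_cancel, elemGL_zero, mul_one]
    rw [← rep_mul_apply, key, rep_mul_apply]
    exact hlow _ hs _ (hall c)

end Generation

section FixedLine

theorem exists_ne_zero_fixed_zmod {p : ℕ} [Fact p.Prime] {P : Type*} [Group P] [Finite P]
    (hP : IsPGroup p P) {V : Type*} [AddCommGroup V] [Module (ZMod p) V]
    (ρ : Representation (ZMod p) P V) {v : V} (hv : v ≠ 0) : ∃ w : V, w ≠ 0 ∧ ∀ g, ρ g w = w := by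
  set W : Submodule (ZMod p) V := Submodule.span (ZMod p) (Set.range fun g => ρ g v) with hW
  have hfin : Module.Finite (ZMod p) W :=
    Module.Finite.span_of_finite (ZMod p) (Set.finite_range fun g => ρ g v)
  have hstab : ∀ g, ∀ w ∈ W, ρ g w ∈ W := by
    intro g w hw
    have : W ≤ W.comap (ρ g) := by
      rw [hW, Submodule.span_le]
      rintro _ ⟨h, rfl⟩
      exact Submodule.subset_span ⟨g * h, by simp⟩
    exact this hw
  let _ : MulAction P W :=
    { smul := fun g w => ⟨ρ g w, hstab g w w.2⟩
      one_smul := fun w => Subtype.ext (by change ρ 1 (w : V) = w; simp)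
      mul_smul := fun g h w => Subtype.ext (by
        change ρ (g * h) (w : V) = ρ g (ρ h (w : V)); simp) }
  have : Finite W := Module.finite_of_finite (ZMod p)
  have hv' : (⟨v, Submodule.subset_span ⟨1, by simp⟩⟩ : W) ≠ 0 := fun h => hv congr(($h : V))
  have : Nontrivial W := ⟨_, _, hv'⟩
  have hcard : p ∣ Nat.card W := by
    rw [Module.natCard_eq_pow_finrank (K := ZMod p), Nat.card_zmod]
    exact dvd_pow_self _ Module.finrank_pos.ne'
  obtain ⟨b, hb, hb0⟩ := hP.exists_fixed_point_of_prime_dvd_card_of_fixed_point W hcard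
    (a := 0) (fun g => Subtype.ext (by change ρ g (0 : V) = 0; simp))
  exact ⟨b, fun h => hb0 (Subtype.ext h.symm), fun g => congr((($(hb g) : W) : V))⟩

/-- A finite `p`-group acting linearly in characteristic `p` on a nonzero space fixes a nonzero
vector. -/
theorem exists_ne_zero_fixed {p : ℕ} [Fact p.Prime] {P : Type*} [Group P] [Finite P]
    (hP : IsPGroup p P) {K : Type*} [Field K] [CharP K p] {V : Type*} [AddCommGroup V] [Module K V]
    (ρ : Representation K P V) {v : V} (hv : v ≠ 0) : ∃ w : V, w ≠ 0 ∧ ∀ g, ρ g w = w := by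
  let _ : Algebra (ZMod p) K := ZMod.algebra K p
  let _ : Module (ZMod p) V := Module.compHom V (algebraMap (ZMod p) K)
  have : IsScalarTower (ZMod p) K V := IsScalarTower.of_compHom _ _ _
  exact exists_ne_zero_fixed_zmod hP
    { toFun := fun g => (ρ g).restrictScalars (ZMod p)
      map_one' := by rw [map_one]; rfl
      map_mul' := fun g h => by rw [map_mul]; rfl } hv

theorem isPGroup_unip {p : ℕ} [Fact p.Prime] (N : ℕ) : IsPGroup p (unip N (ZMod p) (· < ·)) := by
  rintro ⟨g, hg⟩
  obtain ⟨k, hk⟩ : ∃ k, N ≤ p ^ k := ⟨N, (Nat.lt_pow_self (Fact.out : p.Prime).one_lt).le⟩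
  refine ⟨k, Subtype.ext (Units.ext ?_)⟩
  have htri : (g : Matrix (Fin N) (Fin N) (ZMod p)).IsUpperTriangular := fun i j hij =>
    (mem_unip.1 hg).2 i j (ne_of_gt hij) (not_lt_of_gt hij)
  have hch := Matrix.aeval_self_charpoly (g : Matrix (Fin N) (Fin N) (ZMod p))
  rw [Matrix.charpoly_of_isUpperTriangular _ htri, Finset.prod_congr rfl fun i _ => by
    rw [(mem_unip.1 hg).1 i, map_one]] at hch
  simp only [Finset.prod_const, Finset.card_univ, Fintype.card_fin, map_pow, map_sub,
    Polynomial.aeval_X, map_one] at hch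
  have h2 := pow_eq_zero_of_le hk hch
  rcases Nat.eq_zero_or_pos N with rfl | hN
  · exact Subsingleton.elim _ _
  have : Nonempty (Fin N) := ⟨⟨0, hN⟩⟩
  rw [sub_pow_char_pow_of_commute p k (Commute.one_right _), one_pow, sub_eq_zero] at h2
  simpa using h2

theorem dual_irreducible {p n : ℕ} [Fact p.Prime] {K : Type*} [Field K] {V : Type*}
    [AddCommGroup V] [Module K V] [FiniteDimensional K V] {ρ : Representation K (Gk p (n + 1)) V}
    (hirr : ∀ W : Submodule K V, (∀ g v, v ∈ W → ρ g v ∈ W) → W = ⊥ ∨ W = ⊤)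
    (W : Submodule K (Module.Dual K V)) (hW : ∀ g l, l ∈ W → ρ.dual g l ∈ W) :
    W = ⊥ ∨ W = ⊤ := by
  have hstab : ∀ g v, v ∈ W.dualCoannihilator → ρ g v ∈ W.dualCoannihilator := by
    intro g v hv
    rw [Submodule.mem_dualCoannihilator] at hv ⊢
    intro l hl
    have h := hv _ (hW g⁻¹ l hl)
    change l (ρ g⁻¹⁻¹ v) = 0 at h
    rwa [inv_inv] at h
  rw [← Subspace.dualCoannihilator_dualAnnihilator_eq (W := W)]
  rcases hirr _ hstab with h | h
  · right
    rw [h, Submodule.dualAnnihilator_bot]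
  · left
    rw [h, Submodule.dualAnnihilator_top]

variable {p n : ℕ} [Fact p.Prime] {K : Type*} [Field K] [IsAlgClosed K] [CharP K p]
  {V : Type*} [AddCommGroup V] [Module K V] [FiniteDimensional K V]

theorem exists_isBorelEigen (ρ : Representation K (Gk p (n + 1)) V) {v : V} (hv : v ≠ 0) :
    ∃ m : V, m ≠ 0 ∧ IsBorelEigen ρ m := by
  obtain ⟨w, hw0, hw⟩ := exists_ne_zero_fixed (isPGroup_unip (n + 1))
    (ρ.comp (unip (n + 1) (ZMod p) (· < ·)).subtype) hv
  let D : (Fin (n + 1) → (ZMod p)ˣ) → Module.End K V := fun d => ρ (diagHom (n + 1) (ZMod p) d)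
  have hDD : ∀ d e v, D d (D e v) = D e (D d v) := fun d e v => by
    simp only [D, ← rep_mul_apply, ← map_mul, mul_comm]
  let F : Submodule K V :=
    { carrier := {v | ∀ u ∈ unip (n + 1) (ZMod p) (· < ·), ρ u v = v}
      add_mem' := fun {a b} ha hb u hu => by rw [map_add, ha u hu, hb u hu]
      zero_mem' := fun u _ => map_zero _
      smul_mem' := fun c a ha u hu => by rw [map_smul, ha u hu] }
  have hF : ∀ d, ∀ v ∈ F, D d v ∈ F := by
    intro d v hv u hu
    have h := hv _ (diagHom_conj_mem_unip d⁻¹ hu)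
    simp only [D]
    rw [map_inv, inv_inv] at h
    conv_rhs => rw [← h, ← rep_mul_apply]
    rw [← rep_mul_apply]
    congr 2
    group
  obtain ⟨W, hWmin⟩ := exists_minimal_of_wellFoundedLT
    (fun W : Submodule K V => W ≠ ⊥ ∧ W ≤ F ∧ ∀ d, ∀ v ∈ W, D d v ∈ W)
    ⟨F, fun h => hw0 ((Submodule.eq_bot_iff _).1 h w fun u hu => hw ⟨u, hu⟩), le_rfl, hF⟩
  obtain ⟨hW0, hWF, hWD⟩ := hWmin.prop
  obtain ⟨m, hmW, hm0⟩ := Submodule.exists_mem_ne_zero_of_ne_bot hW0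
  refine ⟨m, hm0, hWF hmW, fun d => ?_⟩
  have : Nontrivial W := (Submodule.nontrivial_iff_ne_bot).2 hW0
  obtain ⟨c, hc⟩ := Module.End.exists_eigenvalue ((D d).restrict (hWD d))
  obtain ⟨x, hx⟩ := hc.exists_hasEigenvector
  have hx1 : D d x = c • (x : V) := congr(($(hx.apply_eq_smul) : V))
  have hle : W ≤ W ⊓ Module.End.eigenspace (D d) c := by
    refine hWmin.le_of_le ⟨?_, inf_le_left.trans hWF, fun e v hv => ⟨hWD e v hv.1, ?_⟩⟩ inf_le_left
    · intro h
      refine hx.2 (Subtype.ext ((Submodule.eq_bot_iff _).1 h x ⟨x.2, ?_⟩))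
      exact Module.End.mem_eigenspace_iff.2 hx1
    · rw [SetLike.mem_coe, Module.End.mem_eigenspace_iff, hDD,
        Module.End.mem_eigenspace_iff.1 hv.2, map_smul]
  exact ⟨c, Module.End.mem_eigenspace_iff.1 (hle hmW).2⟩

/-- The vectors of an irreducible representation fixed by the upper triangular unipotent
matrices form at most a line. -/
theorem exists_smul_of_fixed {ρ : Representation K (Gk p (n + 1)) V}
    (hirr : ∀ W : Submodule K V, (∀ g v, v ∈ W → ρ g v ∈ W) → W = ⊥ ∨ W = ⊤)
    {v₀ : V} (hv₀ : v₀ ≠ 0) (hfix : ∀ u ∈ unip (n + 1) (ZMod p) (· < ·), ρ u v₀ = v₀)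
    {v : V} (hv : ∀ u ∈ unip (n + 1) (ZMod p) (· < ·), ρ u v = v) : ∃ c : K, v = c • v₀ := by
  obtain ⟨l, hl⟩ : ∃ l : Module.Dual K V, l v₀ ≠ 0 := by
    by_contra! h
    exact hv₀ ((Module.forall_dual_apply_eq_zero_iff K v₀).1 h)
  obtain ⟨l', hl', hB⟩ := exists_isBorelEigen ρ.dual (v := l) (by rintro rfl; simp at hl)
  obtain ⟨m, hm0, hm, hT⟩ := hB.exists_heckeEigen hl'
  have hspan := hm.span_eq_top hm0 hT (dual_irreducible hirr)
  set w := permHom (n + 1) (ZMod p) Fin.revPerm with hw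
  have key : ∀ x : V, (∀ u ∈ unip (n + 1) (ZMod p) (· < ·), ρ u x = x) → m (ρ w x) = 0 → x = 0 := by
    intro x hx hmx
    have h1 : ∀ f : Module.Dual K V, f (ρ w x) = 0 := by
      intro f
      have hf : f ∈ Submodule.span K
        ((fun u => ρ.dual u m) '' (unip (n + 1) (ZMod p) (· > ·) : Set _)) := hspan ▸ trivial
      induction hf using Submodule.span_induction with
      | zero => rfl
      | add a b _ _ ha hb => rw [LinearMap.add_apply, ha, hb, add_zero]
      | smul c a _ ha => rw [LinearMap.smul_apply, ha, smul_zero]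
      | mem f hf =>
        obtain ⟨u, hu, rfl⟩ := hf
        have h2 := hx _ (permHom_conj_mem_unip (r' := (· < ·)) Fin.revPerm⁻¹ (inv_mem hu)
          (fun a b _ hab => by simpa using hab))
        rw [map_inv, inv_inv, ← hw] at h2
        have h3 : ρ u⁻¹ (ρ w x) = ρ w x := by
          conv_rhs => rw [← h2]
          simp only [← rep_mul_apply]
          congr 2
          group
        change m (ρ u⁻¹ (ρ w x)) = 0
        rw [h3, hmx]
    have h2 := (Module.forall_dual_apply_eq_zero_iff K _).1 h1
    simpa using congr(ρ w⁻¹ $h2)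
  have hm1 : m (ρ w v₀) ≠ 0 := fun h => hv₀ (key _ hfix h)
  refine ⟨m (ρ w v) / m (ρ w v₀), ?_⟩
  rw [← sub_eq_zero]
  refine key _ (fun u hu => by rw [map_sub, map_smul, hv u hu, hfix u hu]) ?_
  simp [hm1]

end FixedLine

section Padic

variable {p : ℕ} [Fact p.Prime] {N : ℕ}

theorem toZMod_eq_zero_iff (x : ℤ_[p]) : PadicInt.toZMod x = 0 ↔ ‖(x : ℚ_[p])‖ < 1 := by
  rw [← RingHom.mem_ker, PadicInt.ker_toZMod, IsLocalRing.mem_maximalIdeal, PadicInt.mem_nonunits]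
  rfl

theorem iotaM_apply (m : MM p N) (i j : Fin N) :
    (iotaM p N m : Matrix (Fin N) (Fin N) ℚ_[p]) i j =
      ((m : Matrix (Fin N) (Fin N) ℤ_[p]) i j : ℚ_[p]) := rfl

theorem redM_apply (m : MM p N) (i j : Fin N) :
    (redM p N m : Matrix (Fin N) (Fin N) (ZMod p)) i j =
      PadicInt.toZMod ((m : Matrix (Fin N) (Fin N) ℤ_[p]) i j) := rfl

theorem iotaM_injective : Function.Injective (iotaM p N) := fun a b h =>
  Matrix.GeneralLinearGroup.ext fun i j => Subtype.ext <| by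
    rw [← iotaM_apply, ← iotaM_apply, h]

theorem iotaM_permHom (σ : Equiv.Perm (Fin N)) :
    iotaM p N (permHom N ℤ_[p] σ) = permHom N ℚ_[p] σ := by
  refine Matrix.GeneralLinearGroup.ext fun i j => ?_
  rw [iotaM_apply, permHom_apply, permHom_apply]
  split_ifs <;> rfl

theorem permGL_eq (σ : Equiv.Perm (Fin N)) : permGL p N σ = permHom N ℚ_[p] σ := by
  refine Matrix.GeneralLinearGroup.ext fun i j => ?_
  rw [permHom_apply]
  simp only [permGL, Equiv.Perm.permMatrix, PEquiv.toMatrix_apply, Equiv.toPEquiv_apply,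
    Option.mem_def, Option.some.injEq]
  exact if_congr ⟨fun h => by simp [← h], fun h => by simp [h]⟩ rfl rfl

/-- The diagonal matrix with powers `ϖ^{b_i}` of the uniformizer. -/
def piDiag (p : ℕ) [Fact p.Prime] {N : ℕ} (b : Fin N → ℤ) : GG p N :=
  diagHom N ℚ_[p] fun i => pU p ^ b i

theorem tGL_eq (a : Fin (N - 1) → ℤ) : tGL p N a = piDiag p (expo N a) := rfl

theorem piSc_eq (n : ℤ) : piSc p N n = piDiag p fun _ => n := by
  refine Matrix.GeneralLinearGroup.ext fun i j => ?_
  change (algebraMap ℚ_[p] (Matrix (Fin N) (Fin N) ℚ_[p]) _) i j = _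
  rw [Matrix.algebraMap_matrix_apply, piDiag, diagHom_val, Matrix.diagonal_apply]
  rfl

theorem piDiag_mul (b c : Fin N → ℤ) : piDiag p b * piDiag p c = piDiag p (b + c) := by
  rw [piDiag, piDiag, ← map_mul]
  exact congrArg _ (funext fun i => (_root_.zpow_add _ _ _).symm)

theorem piSc_comm (n : ℤ) (g : GG p N) : piSc p N n * g = g * piSc p N n := by
  refine Units.ext ?_
  simp only [Units.val_mul, piSc, scalarGL]
  exact Algebra.commutes _ _

theorem piSc_add (m n : ℤ) : piSc p N (m + n) = piSc p N m * piSc p N n := by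
  rw [piSc_eq, piSc_eq, piSc_eq, piDiag_mul]
  rfl

theorem piSc_zero : piSc p N 0 = 1 := by
  simp [piSc, scalarGL]

theorem piSc_neg (n : ℤ) : piSc p N (-n) = (piSc p N n)⁻¹ := by
  rw [eq_inv_iff_mul_eq_one, ← piSc_add, neg_add_cancel, piSc_zero]

theorem norm_pU_zpow (k : ℤ) : ‖((pU p ^ k : ℚ_[p]ˣ) : ℚ_[p])‖ = (p : ℝ) ^ (-k) := by
  rw [Units.val_zpow_eq_zpow_val]
  exact Padic.norm_p_zpow k

theorem one_lt_prime_real : (1 : ℝ) < p := by exact_mod_cast (Fact.out : p.Prime).one_lt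

theorem norm_det_piDiag (b : Fin N → ℤ) :
    ‖(piDiag p b : Matrix (Fin N) (Fin N) ℚ_[p]).det‖ = (p : ℝ) ^ (-∑ i, b i) := by
  have h0 : (p : ℝ) ≠ 0 := (zero_lt_one.trans one_lt_prime_real).ne'
  rw [piDiag, diagHom_val, Matrix.det_diagonal, norm_prod, ← Finset.sum_neg_distrib]
  simp only [norm_pU_zpow]
  induction (Finset.univ : Finset (Fin N)) using Finset.cons_induction with
  | empty => simp
  | cons a s ha ih => rw [Finset.prod_cons, Finset.sum_cons, zpow_add₀ h0, ih]

theorem norm_det_iotaM (m : MM p N) : ‖(iotaM p N m : Matrix (Fin N) (Fin N) ℚ_[p]).det‖ = 1 := by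
  have h : (iotaM p N m : Matrix (Fin N) (Fin N) ℚ_[p]).det =
      (((m : Matrix (Fin N) (Fin N) ℤ_[p]).det : ℤ_[p]) : ℚ_[p]) :=
    (RingHom.map_det PadicInt.Coe.ringHom _).symm
  rw [h]
  exact PadicInt.isUnit_iff.1 ((Matrix.isUnit_iff_isUnit_det _).1 m.isUnit)

theorem mem_Kset_iff {g : GG p N} : g ∈ Kset p N ↔
    (∀ i j, ‖(g : Matrix (Fin N) (Fin N) ℚ_[p]) i j‖ ≤ 1) ∧
      ‖(g : Matrix (Fin N) (Fin N) ℚ_[p]).det‖ = 1 := by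
  constructor
  · rintro ⟨m, rfl⟩
    exact ⟨fun i j => PadicInt.norm_le_one _, norm_det_iotaM m⟩
  · rintro ⟨h1, h2⟩
    let A : Matrix (Fin N) (Fin N) ℤ_[p] := Matrix.of fun i j => ⟨_, h1 i j⟩
    have hA : ((A.det : ℤ_[p]) : ℚ_[p]) = (g : Matrix (Fin N) (Fin N) ℚ_[p]).det :=
      RingHom.map_det PadicInt.Coe.ringHom A
    have hu : IsUnit A.det := by
      rw [PadicInt.isUnit_iff, PadicInt.norm_def, hA, h2]
    exact ⟨((Matrix.isUnit_iff_isUnit_det A).2 hu).unit,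
      Matrix.GeneralLinearGroup.ext fun i j => rfl⟩

theorem mem_Iset_iff {g : GG p N} : g ∈ Iset p N ↔ g ∈ Kset p N ∧
    ∀ i j, j < i → ‖(g : Matrix (Fin N) (Fin N) ℚ_[p]) i j‖ < 1 := by
  constructor
  · rintro ⟨m, hm, rfl⟩
    exact ⟨⟨m, rfl⟩, fun i j hij => (toZMod_eq_zero_iff _).1 (hm i j hij)⟩
  · rintro ⟨⟨m, rfl⟩, h⟩
    exact ⟨m, fun i j hij => (toZMod_eq_zero_iff _).2 (h i j hij), rfl⟩

theorem mem_I1set_iff {g : GG p N} : g ∈ I1set p N ↔ g ∈ Iset p N ∧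
    ∀ i, ‖(g : Matrix (Fin N) (Fin N) ℚ_[p]) i i - 1‖ < 1 := by
  have key : ∀ (m : MM p N) (i : Fin N),
      (redM p N m : Matrix (Fin N) (Fin N) (ZMod p)) i i = 1 ↔
      ‖(iotaM p N m : Matrix (Fin N) (Fin N) ℚ_[p]) i i - 1‖ < 1 := by
    intro m i
    rw [redM_apply, ← sub_eq_zero, ← map_one PadicInt.toZMod, ← map_sub, toZMod_eq_zero_iff]
    rfl
  constructor
  · rintro ⟨m, hm, rfl⟩
    exact ⟨⟨m, hm.1, rfl⟩, fun i => (key m i).1 (hm.2 i)⟩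
  · rintro ⟨⟨m, hm, rfl⟩, h⟩
    exact ⟨m, ⟨hm, fun i => (key m i).2 (h i)⟩, rfl⟩

theorem I1set_subset_Iset : I1set p N ⊆ Iset p N := fun _ h => (mem_I1set_iff.1 h).1

theorem mem_I1pre_iff {m : MM p N} : m ∈ I1pre p N ↔ redM p N m ∈ unip N (ZMod p) (· < ·) := by
  rw [mem_unip]
  constructor
  · rintro ⟨h1, h2⟩
    exact ⟨h2, fun a b hab h => h1 a b (lt_of_le_of_ne (not_lt.1 h) hab.symm)⟩
  · rintro ⟨h1, h2⟩
    exact ⟨fun i j hij => h2 i j hij.ne' (not_lt_of_gt hij), h1⟩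

/-- The pro-`p` Iwahori subgroup, as a subgroup of `G`. -/
def I1grp (p : ℕ) [Fact p.Prime] (N : ℕ) : Subgroup (GG p N) :=
  ((unip N (ZMod p) (· < ·)).comap (redM p N)).map (iotaM p N)

theorem coe_I1grp : (I1grp p N : Set (GG p N)) = I1set p N := by
  have h : I1pre p N = ((unip N (ZMod p) (· < ·)).comap (redM p N) : Set (MM p N)) :=
    Set.ext fun m => mem_I1pre_iff
  rw [I1grp, Subgroup.coe_map, I1set, h]

theorem mem_I1grp {g : GG p N} : g ∈ I1grp p N ↔ g ∈ I1set p N := by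
  rw [← coe_I1grp, SetLike.mem_coe]

theorem isOpen_I1set : IsOpen (I1set p N) := by
  have hc : ∀ i j, Continuous fun g : GG p N => (g : Matrix (Fin N) (Fin N) ℚ_[p]) i j :=
    fun i j => Units.continuous_val.matrix_elem i j
  have hd : Continuous fun g : GG p N => (g : Matrix (Fin N) (Fin N) ℚ_[p]).det :=
    Units.continuous_val.matrix_det
  have h : I1set p N =
      ((⋂ i, ⋂ j, (fun g : GG p N => (g : Matrix (Fin N) (Fin N) ℚ_[p]) i j) ⁻¹'
          Metric.closedBall 0 1) ∩
        (fun g : GG p N => (g : Matrix (Fin N) (Fin N) ℚ_[p]).det) ⁻¹' Metric.sphere 0 1) ∩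
      (⋂ i, ⋂ j, ⋂ _ : j < i, (fun g : GG p N => (g : Matrix (Fin N) (Fin N) ℚ_[p]) i j) ⁻¹'
          Metric.ball 0 1) ∩
      ⋂ i, (fun g : GG p N => (g : Matrix (Fin N) (Fin N) ℚ_[p]) i i) ⁻¹' Metric.ball 1 1 := by
    ext g
    rw [mem_I1set_iff, mem_Iset_iff, mem_Kset_iff]
    simp [dist_eq_norm]
  rw [h]
  refine ((IsOpen.inter ?_ ?_).inter ?_).inter ?_
  · exact isOpen_iInter_of_finite fun i => isOpen_iInter_of_finite fun j =>
      (IsUltrametricDist.isOpen_closedBall 0 one_ne_zero).preimage (hc i j)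
  · exact (IsUltrametricDist.isOpen_sphere 0 one_ne_zero).preimage hd
  · exact isOpen_iInter_of_finite fun i => isOpen_iInter_of_finite fun j =>
      isOpen_iInter_of_finite fun _ => Metric.isOpen_ball.preimage (hc i j)
  · exact isOpen_iInter_of_finite fun i => Metric.isOpen_ball.preimage (hc i i)

end Padic

section Chambers

variable {N : ℕ}

/-- The strict total order on indices attached to `b ∈ ℤ^N`. -/
def lexKey (b : Fin N → ℤ) (i : Fin N) : ℤ ×ₗ Fin N := toLex (b i, i)

theorem lexKey_lt_iff {b : Fin N → ℤ} {i j : Fin N} :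
    lexKey b i < lexKey b j ↔ b i < b j ∨ b i = b j ∧ i < j := by
  simp [lexKey, Prod.Lex.toLex_lt_toLex]

theorem lexKey_injective (b : Fin N → ℤ) : Function.Injective (lexKey b) := fun i j h => by
  simpa [lexKey] using congrArg (fun x => (ofLex x).2) h

theorem exists_perm_lexKey (b : Fin N → ℤ) :
    ∃ σ : Equiv.Perm (Fin N), ∀ i j, lexKey b i < lexKey b j → σ i < σ j := by
  refine ⟨(Tuple.sort (lexKey b))⁻¹, fun i j h => ?_⟩
  by_contra! hle
  have h2 := Tuple.monotone_sort (lexKey b) hle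
  simp only [Function.comp_apply, ← Equiv.Perm.mul_apply, mul_inv_cancel, Equiv.Perm.one_apply] at h2
  exact absurd h (not_lt_of_ge h2)

theorem perm_lexKey_unique {b : Fin N → ℤ} {σ τ : Equiv.Perm (Fin N)}
    (hσ : ∀ i j, lexKey b i < lexKey b j → σ i < σ j)
    (hτ : ∀ i j, lexKey b i < lexKey b j → τ i < τ j) : σ = τ := by
  have h1 : StrictMono ⇑(τ * σ⁻¹) := by
    intro x y hxy
    rcases lt_trichotomy (lexKey b (σ⁻¹ x)) (lexKey b (σ⁻¹ y)) with h | h | h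
    · exact hτ _ _ h
    · exact absurd (σ⁻¹.injective (lexKey_injective b h)) hxy.ne
    · exact absurd (by simpa using hσ _ _ h) (not_lt_of_gt hxy)
  have h2 := (h1.range_inj strictMono_id).1 (by simp)
  have h3 : τ * σ⁻¹ = 1 := Equiv.ext fun i => congrFun h2 i
  exact (mul_inv_eq_one.1 h3).symm

end Chambers

section DoubleCosets

variable {p : ℕ} [Fact p.Prime] {N : ℕ}

theorem wS_eq (σ : Equiv.Perm (Fin N)) (a : Fin (N - 1) → ℤ) :
    wS p N σ a = iotaM p N (permHom N ℤ_[p] σ) * tGL p N a := by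
  rw [wS, permGL_eq, iotaM_permHom]

theorem wS_conj_apply (σ : Equiv.Perm (Fin N)) (a : Fin (N - 1) → ℤ) (g : GG p N) (i j : Fin N) :
    ((wS p N σ a * g * (wS p N σ a)⁻¹ : GG p N) : Matrix (Fin N) (Fin N) ℚ_[p]) (σ i) (σ j) =
      ((pU p ^ expo N a i : ℚ_[p]ˣ) : ℚ_[p]) * (g : Matrix (Fin N) (Fin N) ℚ_[p]) i j *
        ((pU p ^ (-expo N a j) : ℚ_[p]ˣ) : ℚ_[p]) := by
  have h : wS p N σ a * g * (wS p N σ a)⁻¹ = permHom N ℚ_[p] σ *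
      (tGL p N a * g * (tGL p N a)⁻¹) * (permHom N ℚ_[p] σ)⁻¹ := by
    rw [wS, permGL_eq]
    group
  have hσ : ∀ i, σ⁻¹ (σ i) = i := fun i => σ.symm_apply_apply i
  rw [h, permHom_conj_apply, hσ, hσ, tGL_eq, piDiag,
    diagHom_conj_apply, _root_.zpow_neg]

theorem norm_wS_conj_apply (σ : Equiv.Perm (Fin N)) (a : Fin (N - 1) → ℤ) (g : GG p N)
    (i j : Fin N) :
    ‖((wS p N σ a * g * (wS p N σ a)⁻¹ : GG p N) : Matrix (Fin N) (Fin N) ℚ_[p]) (σ i) (σ j)‖ =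
      ‖(g : Matrix (Fin N) (Fin N) ℚ_[p]) i j‖ * (p : ℝ) ^ (expo N a j - expo N a i) := by
  have h0 : (p : ℝ) ≠ 0 := (zero_lt_one.trans one_lt_prime_real).ne'
  rw [wS_conj_apply, norm_mul, norm_mul, norm_pU_zpow, norm_pU_zpow, neg_neg, sub_eq_add_neg,
    zpow_add₀ h0]
  ring

theorem norm_entry_le_one {g : GG p N} (hg : g ∈ Kset p N) (i j : Fin N) :
    ‖(g : Matrix (Fin N) (Fin N) ℚ_[p]) i j‖ ≤ 1 := (mem_Kset_iff.1 hg).1 i j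

theorem mem_Sset_iff {σ : Equiv.Perm (Fin N)} {a : Fin (N - 1) → ℤ} : a ∈ Sset p N σ ↔
    ∀ i j, lexKey (expo N a) i < lexKey (expo N a) j → σ i < σ j := by
  have hp1 := one_lt_prime_real (p := p)
  constructor
  · intro ha i j hij
    have hne : i ≠ j := fun h => by simp [h] at hij
    have hσne : σ i ≠ σ j := σ.injective.ne hne
    set x : GG p N := elemGL i j hne ((pU p ^ (expo N a j - expo N a i) : ℚ_[p]ˣ) : ℚ_[p]) with hx
    have hc : ‖((pU p ^ (expo N a j - expo N a i) : ℚ_[p]ˣ) : ℚ_[p])‖ ≤ 1 := by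
      rw [norm_pU_zpow, neg_sub]
      refine zpow_le_one_of_nonpos₀ hp1.le ?_
      rcases lexKey_lt_iff.1 hij with h | h <;> omega
    have hxI : x ∈ Iset p N := by
      refine mem_Iset_iff.2 ⟨mem_Kset_iff.2 ⟨fun k l => ?_, ?_⟩, fun k l hkl => ?_⟩
      · rw [hx, elemGL_apply]
        refine (Padic.nonarchimedean _ _).trans (max_le ?_ ?_)
        · split_ifs <;> simp
        · split_ifs
          · exact hc
          · simp
      · rw [hx]
        change ‖(transvection i j _).det‖ = 1
        rw [det_transvection_of_ne _ _ hne, norm_one]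
      · rw [hx, elemGL_apply, if_neg hkl.ne', zero_add]
        split_ifs with h
        · rw [norm_pU_zpow, neg_sub]
          refine zpow_lt_one_of_neg₀ hp1 ?_
          rcases lexKey_lt_iff.1 hij with h' | h'
          · omega
          · rw [h.1, h.2] at hkl
            exact absurd hkl (not_lt_of_gt h'.2)
        · simp
    have hconj : wS p N σ a * x * (wS p N σ a)⁻¹ = iotaM p N (elemGL (σ i) (σ j) hσne 1) := by
      refine Matrix.GeneralLinearGroup.ext fun k l => ?_
      obtain ⟨k, rfl⟩ := σ.surjective k
      obtain ⟨l, rfl⟩ := σ.surjective l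
      rw [wS_conj_apply, iotaM_apply, elemGL_apply, elemGL_apply]
      simp only [EmbeddingLike.apply_eq_iff_eq]
      by_cases h1 : k = l
      · subst h1
        have h2 : ¬ (k = i ∧ k = j) := fun h => hne (h.1.symm.trans h.2)
        rw [if_pos rfl, if_pos rfl, if_neg h2, if_neg h2, add_zero, add_zero, mul_one,
          ← Units.val_mul, _root_.zpow_neg, mul_inv_cancel]
        rfl
      · rw [if_neg h1, if_neg h1]
        by_cases h2 : k = i ∧ l = j
        · obtain ⟨rfl, rfl⟩ := h2
          simp only [and_self, if_true, zero_add]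
          rw [← Units.val_mul, ← Units.val_mul, ← _root_.zpow_add, ← _root_.zpow_add]
          simp
        · simp [h2]
    have hI := ha x hxI (hconj ▸ ⟨_, rfl⟩)
    rw [hconj] at hI
    refine lt_of_le_of_ne (not_lt.1 fun hlt => ?_) hσne
    have := (mem_Iset_iff.1 hI).2 _ _ hlt
    rw [iotaM_apply, elemGL_apply] at this
    simp [hσne] at this
  · intro h g hg hK
    refine mem_Iset_iff.2 ⟨hK, fun k l hkl => ?_⟩
    obtain ⟨k, rfl⟩ := σ.surjective k
    obtain ⟨l, rfl⟩ := σ.surjective l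
    rw [norm_wS_conj_apply]
    have hlt : lexKey (expo N a) l < lexKey (expo N a) k := by
      refine lt_of_le_of_ne (not_lt.1 fun hlt => ?_) fun h => hkl.ne ?_
      · exact absurd (h _ _ hlt) (not_lt_of_gt hkl)
      · rw [lexKey_injective _ h]
    rcases lexKey_lt_iff.1 hlt with h1 | ⟨h1, h2⟩
    · refine mul_lt_one_of_nonneg_of_lt_one_right ((mem_Kset_iff.1 (mem_Iset_iff.1 hg).1).1 _ _)
        (zpow_nonneg (zero_le_one.trans hp1.le) _) (zpow_lt_one_of_neg₀ hp1 (by omega))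
    · rw [h1, sub_self, zpow_zero, mul_one]
      exact (mem_Iset_iff.1 hg).2 _ _ h2

theorem exists_mem_Sset (a : Fin (N - 1) → ℤ) : ∃ σ, a ∈ Sset p N σ :=
  (exists_perm_lexKey (expo N a)).imp fun _ h => mem_Sset_iff.2 h

theorem Sset_unique {a : Fin (N - 1) → ℤ} {σ τ : Equiv.Perm (Fin N)} (hσ : a ∈ Sset p N σ)
    (hτ : a ∈ Sset p N τ) : σ = τ :=
  perm_lexKey_unique (mem_Sset_iff.1 hσ) (mem_Sset_iff.1 hτ)

theorem norm_diag_of_mem_I1set {u : GG p N} (hu : u ∈ I1set p N) (i : Fin N) :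
    ‖(u : Matrix (Fin N) (Fin N) ℚ_[p]) i i‖ = 1 := by
  have h := (mem_I1set_iff.1 hu).2 i
  rw [← norm_one (α := ℚ_[p])] at h
  rw [Padic.norm_eq_of_norm_sub_lt_right h, norm_one]

theorem eq_add_of_piDiag_eq {b c : Fin N → ℤ} {n : ℤ} {k u : GG p N} (hk : k ∈ Kset p N)
    (hu : u ∈ I1set p N) (h : piDiag p b = piSc p N n * k * piDiag p c * u) (i : Fin N) :
    b i = n + c i := by
  have hp1 := one_lt_prime_real (p := p)
  have h0 : (p : ℝ) ≠ 0 := (zero_lt_one.trans hp1).ne'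
  have hu' : u⁻¹ ∈ I1set p N := mem_I1grp.1 (inv_mem (mem_I1grp.2 hu))
  have hk2 : k = piDiag p ((fun _ => -n) + b) * u⁻¹ * (piDiag p c)⁻¹ := by
    rw [← piDiag_mul, ← piSc_eq, piSc_neg, h]
    group
  have hle : ∀ i, n + c i ≤ b i := by
    intro i
    have h1 := norm_entry_le_one hk i i
    rw [hk2, piDiag, piDiag, ← map_inv, Units.val_mul, mul_diagHom_apply, Units.val_mul,
      diagHom_mul_apply, norm_mul, norm_mul, norm_diag_of_mem_I1set hu', norm_pU_zpow, mul_one,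
      Pi.inv_apply, ← _root_.zpow_neg, norm_pU_zpow, ← zpow_add₀ h0] at h1
    by_contra! hlt
    exact absurd h1 (not_le_of_gt (one_lt_zpow₀ hp1 (by simp only [Pi.add_apply]; omega)))
  have hdet : ∑ i, b i = ∑ i, (n + c i) := by
    have h1 := congr(‖($h : Matrix (Fin N) (Fin N) ℚ_[p]).det‖)
    rw [piSc_eq] at h1
    simp only [Units.val_mul, det_mul, norm_mul, norm_det_piDiag, (mem_Kset_iff.1 hk).2,
      (mem_Kset_iff.1 (mem_Iset_iff.1 (I1set_subset_Iset hu)).1).2, mul_one] at h1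
    rw [← zpow_add₀ h0] at h1
    have h2 := zpow_right_injective₀ (zero_lt_one.trans hp1) hp1.ne' h1
    rw [Finset.sum_add_distrib]
    omega
  exact ((Finset.sum_eq_sum_iff_of_le fun i _ => hle i).1 hdet.symm i (Finset.mem_univ i)).symm

end DoubleCosets

section StandardFunctions

variable {p : ℕ} [Fact p.Prime] {N : ℕ}

theorem expo_of_lt (a : Fin (N - 1) → ℤ) {i : Fin N} (h : (i : ℕ) < N - 1) :
    expo N a i = a ⟨i, h⟩ := dif_pos h

theorem expo_of_not_lt (a : Fin (N - 1) → ℤ) {i : Fin N} (h : ¬ (i : ℕ) < N - 1) :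
    expo N a i = 0 := dif_neg h

theorem eq_of_expo_eq_add (hN : 0 < N) {a b : Fin (N - 1) → ℤ} {n : ℤ}
    (h : ∀ i, expo N a i = n + expo N b i) : n = 0 ∧ a = b := by
  have hn : n = 0 := by
    have h1 := h ⟨N - 1, by omega⟩
    rw [expo_of_not_lt _ (by simp), expo_of_not_lt _ (by simp)] at h1
    omega
  refine ⟨hn, funext fun i => ?_⟩
  have h1 := h ⟨i, by omega⟩
  rw [expo_of_lt _ i.2, expo_of_lt _ i.2, hn, zero_add] at h1
  exact h1

theorem eq_of_coset_eq (hN : 0 < N) {σ τ : Equiv.Perm (Fin N)} {a b : Fin (N - 1) → ℤ} {n n' : ℤ}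
    {m m' : MM p N} {u u' : GG p N} (hu : u ∈ I1set p N) (hu' : u' ∈ I1set p N)
    (h : piSc p N n * iotaM p N m * wS p N σ a * u =
      piSc p N n' * iotaM p N m' * wS p N τ b * u') : n = n' ∧ a = b := by
  have hk : tGL p N a = piSc p N (n' - n) *
      iotaM p N ((permHom N ℤ_[p] σ)⁻¹ * m⁻¹ * m' * permHom N ℤ_[p] τ) * tGL p N b *
        (u' * u⁻¹) := by
    have h1 : tGL p N a = (iotaM p N (permHom N ℤ_[p] σ))⁻¹ * (iotaM p N m)⁻¹ *
        (piSc p N n)⁻¹ * (piSc p N n * iotaM p N m * wS p N σ a * u) * u⁻¹ := by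
      rw [wS_eq]
      group
    have h2 := piSc_comm (n' - n) ((iotaM p N (permHom N ℤ_[p] σ))⁻¹ * (iotaM p N m)⁻¹)
    rw [map_mul, map_mul, map_mul, map_inv, map_inv]
    simp only [← mul_assoc] at h2 ⊢
    rw [h2, sub_eq_neg_add, piSc_add, piSc_neg, h1, h, wS_eq]
    simp only [mul_assoc]
  have hmem : u' * u⁻¹ ∈ I1set p N :=
    mem_I1grp.1 (mul_mem (mem_I1grp.2 hu') (inv_mem (mem_I1grp.2 hu)))
  have h1 := eq_of_expo_eq_add hN (eq_add_of_piDiag_eq ⟨_, rfl⟩ hmem hk)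
  exact ⟨by omega, h1.2⟩

theorem inv_mul_mem_I1pre (hN : 0 < N) {σ : Equiv.Perm (Fin N)} {a : Fin (N - 1) → ℤ}
    (ha : a ∈ Sset p N σ) {n n' : ℤ} {m m' : MM p N} {u u' : GG p N} (hu : u ∈ I1set p N)
    (hu' : u' ∈ I1set p N) (h : piSc p N n * iotaM p N m * wS p N σ a * u =
      piSc p N n' * iotaM p N m' * wS p N σ a * u') : m⁻¹ * m' ∈ I1pre p N := by
  obtain ⟨rfl, -⟩ := eq_of_coset_eq hN hu hu' h
  have hk : iotaM p N (m⁻¹ * m') = wS p N σ a * (u * u'⁻¹) * (wS p N σ a)⁻¹ := by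
    simp only [mul_assoc, mul_left_cancel_iff] at h
    rw [map_mul, map_inv, inv_mul_eq_iff_eq_mul]
    simp only [← mul_assoc] at h ⊢
    rw [h]
    group
  have hmem : u * u'⁻¹ ∈ I1set p N :=
    mem_I1grp.1 (mul_mem (mem_I1grp.2 hu) (inv_mem (mem_I1grp.2 hu')))
  have h1 : iotaM p N (m⁻¹ * m') ∈ I1set p N := by
    refine mem_I1set_iff.2 ⟨?_, fun i => ?_⟩
    · rw [hk]
      exact ha _ (I1set_subset_Iset hmem) (hk ▸ ⟨_, rfl⟩)
    · obtain ⟨i, rfl⟩ := σ.surjective i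
      rw [hk, wS_conj_apply, mul_right_comm, ← Units.val_mul, ← _root_.zpow_add, add_neg_cancel,
        zpow_zero, Units.val_one, one_mul]
      exact (mem_I1set_iff.1 hmem).2 i
  obtain ⟨x, hx, hxe⟩ := h1
  rwa [← iotaM_injective hxe]

theorem finite_cosets (σ : Equiv.Perm (Fin N)) (a : Fin (N - 1) → ℤ) :
    ∃ S : Finset (GG p N), ∀ m : MM p N, ∃ s ∈ S, ∃ k : MM p N,
      wS p N σ a * iotaM p N m = iotaM p N k * s := by
  classical
  have hp1 := one_lt_prime_real (p := p)
  set M : ℕ := ∑ i, ∑ j, (expo N a j - expo N a i).natAbs with hM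
  let F : MM p N →* GL (Fin N) (ZMod (p ^ M)) :=
    Matrix.GeneralLinearGroup.map (PadicInt.toZModPow M)
  have hMle : ∀ i j, expo N a j - expo N a i ≤ M := by
    intro i j
    have h1 : (expo N a j - expo N a i).natAbs ≤ M :=
      (Finset.single_le_sum (f := fun j => (expo N a j - expo N a i).natAbs)
        (fun _ _ => Nat.zero_le _) (Finset.mem_univ j)).trans
      (Finset.single_le_sum (f := fun i => ∑ j, (expo N a j - expo N a i).natAbs)
        (fun _ _ => Nat.zero_le _) (Finset.mem_univ i))
    omega
  have hker : ∀ x : MM p N, F x = 1 →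
      wS p N σ a * iotaM p N x * (wS p N σ a)⁻¹ ∈ Kset p N := by
    intro x hx
    refine mem_Kset_iff.2 ⟨fun i j => ?_, ?_⟩
    · obtain ⟨i, rfl⟩ := σ.surjective i
      obtain ⟨j, rfl⟩ := σ.surjective j
      by_cases hij : i = j
      · subst hij
        rw [norm_wS_conj_apply, sub_self, zpow_zero, mul_one]
        exact norm_entry_le_one ⟨x, rfl⟩ _ _
      · have h1 : PadicInt.toZModPow M ((x : Matrix (Fin N) (Fin N) ℤ_[p]) i j) = 0 := by
          have := congr((($hx : GL (Fin N) (ZMod (p ^ M))) :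
            Matrix (Fin N) (Fin N) (ZMod (p ^ M))) i j)
          rwa [Units.val_one, Matrix.one_apply_ne hij] at this
        rw [← RingHom.mem_ker, PadicInt.ker_toZModPow,
          ← PadicInt.norm_le_pow_iff_mem_span_pow] at h1
        rw [norm_wS_conj_apply, iotaM_apply]
        refine (mul_le_mul_of_nonneg_right h1 (zpow_nonneg (zero_le_one.trans hp1.le) _)).trans ?_
        rw [← zpow_add₀ (zero_lt_one.trans hp1).ne']
        refine zpow_le_one_of_nonpos₀ hp1.le ?_
        have := hMle i j
        omega
    · rw [Units.val_mul, Units.val_mul, det_mul, det_mul, mul_right_comm, ← det_mul,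
        ← Units.val_mul, mul_inv_cancel, Units.val_one, det_one, one_mul, norm_det_iotaM]
  let rep : GL (Fin N) (ZMod (p ^ M)) → MM p N := Function.invFun F
  have : NeZero (p ^ M) := ⟨pow_ne_zero _ (Fact.out : p.Prime).ne_zero⟩
  refine ⟨Finset.univ.image fun z => wS p N σ a * iotaM p N (rep z), fun m => ?_⟩
  refine ⟨_, Finset.mem_image_of_mem _ (Finset.mem_univ (F m)), ?_⟩
  obtain ⟨k, hk⟩ := hker (m * (rep (F m))⁻¹) (by
    rw [map_mul, map_inv, mul_inv_eq_one]
    exact (Function.invFun_eq ⟨m, rfl⟩).symm)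
  refine ⟨k, ?_⟩
  rw [hk, map_mul, map_inv]
  group

variable {V : Type} [AddCommGroup V] [Module (kb p) V]

open Classical in
/-- The function supported on `KZ ω t_a I_1` with value `v₀` at `ω t_a`. -/
def stdFun (ρ : Representation (kb p) (Gk p N) V) (v₀ : V) (σ : Equiv.Perm (Fin N))
    (a : Fin (N - 1) → ℤ) (g : GG p N) : V :=
  if h : ∃ x : ℤ × MM p N × GG p N, x.2.2 ∈ I1set p N ∧
    g = piSc p N x.1 * iotaM p N x.2.1 * wS p N σ a * x.2.2
  then ρ (redM p N h.choose.2.1) v₀ else 0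

variable {ρ : Representation (kb p) (Gk p N) V} {v₀ : V} {σ : Equiv.Perm (Fin N)}
  {a : Fin (N - 1) → ℤ}

theorem stdFun_apply (hN : 0 < N) (hfix : ∀ m ∈ I1pre p N, ρ (redM p N m) v₀ = v₀)
    (ha : a ∈ Sset p N σ) (n : ℤ) (m : MM p N) {u : GG p N} (hu : u ∈ I1set p N) :
    stdFun ρ v₀ σ a (piSc p N n * iotaM p N m * wS p N σ a * u) = ρ (redM p N m) v₀ := by
  have h : ∃ x : ℤ × MM p N × GG p N, x.2.2 ∈ I1set p N ∧
      piSc p N n * iotaM p N m * wS p N σ a * u =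
        piSc p N x.1 * iotaM p N x.2.1 * wS p N σ a * x.2.2 := ⟨(n, m, u), hu, rfl⟩
  rw [stdFun, dif_pos h]
  have h1 := hfix _ (inv_mul_mem_I1pre hN ha hu h.choose_spec.1 h.choose_spec.2)
  conv_rhs => rw [← h1]
  rw [← Module.End.mul_apply, ← map_mul, ← map_mul, mul_inv_cancel_left]

theorem stdFun_of_not {g : GG p N} (h : ¬ ∃ x : ℤ × MM p N × GG p N, x.2.2 ∈ I1set p N ∧
    g = piSc p N x.1 * iotaM p N x.2.1 * wS p N σ a * x.2.2) : stdFun ρ v₀ σ a g = 0 := dif_neg h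

theorem isStd_stdFun (hN : 0 < N) (hfix : ∀ m ∈ I1pre p N, ρ (redM p N m) v₀ = v₀)
    (ha : a ∈ Sset p N σ) : IsStd p N ρ v₀ σ a (stdFun ρ v₀ σ a) := by
  have hinv : IsI1Inv p N (stdFun ρ v₀ σ a) := by
    intro u hu g
    by_cases h : ∃ x : ℤ × MM p N × GG p N, x.2.2 ∈ I1set p N ∧
      g = piSc p N x.1 * iotaM p N x.2.1 * wS p N σ a * x.2.2
    · obtain ⟨⟨n, m, u'⟩, hu', rfl⟩ := h
      rw [mul_assoc _ u', stdFun_apply hN hfix ha n m hu', stdFun_apply hN hfix ha n m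
        (mem_I1grp.1 (mul_mem (mem_I1grp.2 hu') (mem_I1grp.2 hu)))]
    · rw [stdFun_of_not h, stdFun_of_not]
      rintro ⟨⟨n, m, u'⟩, hu', hg⟩
      refine h ⟨⟨n, m, u' * u⁻¹⟩,
        mem_I1grp.1 (mul_mem (mem_I1grp.2 hu') (inv_mem (mem_I1grp.2 hu))), ?_⟩
      rw [← mul_assoc, ← hg, mul_inv_cancel_right]
  have hsupp : ∀ g, stdFun ρ v₀ σ a g ≠ 0 → ∃ (n : ℤ) (m : MM p N) (u : GG p N), u ∈ I1set p N ∧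
      g = piSc p N n * iotaM p N m * wS p N σ a * u := by
    intro g hg
    by_contra h
    exact hg (stdFun_of_not fun ⟨x, hx, hgx⟩ => h ⟨x.1, x.2.1, x.2.2, hx, hgx⟩)
  refine ⟨⟨fun n m g => ?_, ?_, I1grp p N, coe_I1grp (p := p) (N := N) ▸ isOpen_I1set,
    fun u hu => hinv u (mem_I1grp.1 hu)⟩, hinv, fun g hg => ?_, ?_⟩
  · by_cases h : ∃ x : ℤ × MM p N × GG p N, x.2.2 ∈ I1set p N ∧
      g = piSc p N x.1 * iotaM p N x.2.1 * wS p N σ a * x.2.2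
    · obtain ⟨⟨n', m', u⟩, hu, rfl⟩ := h
      have h1 : piSc p N n * iotaM p N m * (piSc p N n' * iotaM p N m' * wS p N σ a * u) =
          piSc p N (n + n') * iotaM p N (m * m') * wS p N σ a * u := by
        rw [piSc_add, map_mul]
        simp only [← mul_assoc]
        rw [mul_assoc _ _ (piSc p N n'), ← piSc_comm n', ← mul_assoc]
      rw [h1, stdFun_apply hN hfix ha _ _ hu, stdFun_apply hN hfix ha _ _ hu, map_mul, map_mul,
        Module.End.mul_apply]
    · rw [stdFun_of_not h, map_zero, stdFun_of_not]
      rintro ⟨⟨n', m', u⟩, hu, hg⟩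
      refine h ⟨⟨-n + n', m⁻¹ * m', u⟩, hu, ?_⟩
      have h1 : g = (iotaM p N m)⁻¹ * ((piSc p N n)⁻¹ *
          (piSc p N n' * iotaM p N m' * wS p N σ a * u)) := by
        rw [← hg]
        group
      rw [h1, piSc_add, piSc_neg, map_mul, map_inv, ← piSc_neg, ← mul_assoc, ← piSc_comm]
      simp only [← mul_assoc]
      rw [mul_assoc (piSc p N (-n)), ← piSc_comm n', ← mul_assoc]
  · obtain ⟨S, hS⟩ := finite_cosets (p := p) σ a
    refine ⟨S, fun g hg => ?_⟩
    obtain ⟨n, m, u, ⟨x, -, rfl⟩, rfl⟩ := hsupp g hg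
    obtain ⟨s, hs, k, hk⟩ := hS x
    exact ⟨s, hs, n, m * k, by rw [map_mul, mul_assoc _ (wS p N σ a), hk]; simp only [mul_assoc]⟩
  · obtain ⟨n, m, u, hu, rfl⟩ := hsupp g hg
    refine ⟨n, m * permHom N ℤ_[p] σ, u, hu, ?_⟩
    rw [wS_eq, map_mul]
    simp only [mul_assoc]
  · have := stdFun_apply hN hfix ha 0 1 (one_mem (I1grp p N) |> mem_I1grp.1)
    simpa [piSc_zero] using this

end StandardFunctions

section Shears

variable {N : ℕ} {R : Type*} [CommRing R]

theorem vecMulVec_single_apply (c : Fin N → R) (j k l : Fin N) :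
    vecMulVec c (Pi.single j 1) k l = if l = j then c k else 0 := by
  simp [vecMulVec_apply, Pi.single_apply]

theorem one_add_vecMulVec_mul {c d : Fin N → R} (j : Fin N) (hd : d j = 0) :
    (1 + vecMulVec c (Pi.single j 1)) * (1 + vecMulVec d (Pi.single j 1)) =
      1 + vecMulVec (c + d) (Pi.single j 1) := by
  rw [add_mul, mul_add, mul_add, one_mul, mul_one, one_mul, vecMulVec_mul_vecMulVec,
    single_one_dotProduct, hd, zero_smul, vecMulVec_zero, add_zero, add_vecMulVec]
  abel

/-- The matrix with column `j` equal to `e_j + c`, and the other columns those of the identity. -/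
def colShear (j : Fin N) (c : Fin N → R) (hc : c j = 0) : GL (Fin N) R where
  val := 1 + vecMulVec c (Pi.single j 1)
  inv := 1 + vecMulVec (-c) (Pi.single j 1)
  val_inv := by
    rw [one_add_vecMulVec_mul j (by simp [hc]), add_neg_cancel, zero_vecMulVec, add_zero]
  inv_val := by rw [one_add_vecMulVec_mul j hc, neg_add_cancel, zero_vecMulVec, add_zero]

theorem colShear_apply (j : Fin N) (c : Fin N → R) (hc : c j = 0) (k l : Fin N) :
    (colShear j c hc : Matrix (Fin N) (Fin N) R) k l =
      (if k = l then 1 else 0) + if l = j then c k else 0 := by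
  rw [← vecMulVec_single_apply, ← Matrix.one_apply]
  rfl

/-- The matrix with row `j` equal to `e_j + c`, and the other rows those of the identity. -/
def rowShear (j : Fin N) (c : Fin N → R) (hc : c j = 0) : GL (Fin N) R where
  val := (colShear j c hc : Matrix (Fin N) (Fin N) R)ᵀ
  inv := ((colShear j c hc)⁻¹ : GL (Fin N) R).valᵀ
  val_inv := by rw [← transpose_mul, ← Units.val_mul, inv_mul_cancel]; simp
  inv_val := by rw [← transpose_mul, ← Units.val_mul, mul_inv_cancel]; simp

theorem rowShear_apply (j : Fin N) (c : Fin N → R) (hc : c j = 0) (k l : Fin N) :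
    (rowShear j c hc : Matrix (Fin N) (Fin N) R) k l =
      (if l = k then 1 else 0) + if k = j then c l else 0 := colShear_apply j c hc l k

end Shears

section Decomposition

variable {p : ℕ} [Fact p.Prime] {N : ℕ}

theorem iotaM_colShear_mul_apply (j : Fin N) (c : Fin N → ℤ_[p]) (hc : c j = 0)
    (g : Matrix (Fin N) (Fin N) ℚ_[p]) (k l : Fin N) :
    ((iotaM p N (colShear j c hc) : Matrix (Fin N) (Fin N) ℚ_[p]) * g) k l =
      g k l + (c k : ℚ_[p]) * g j l := by
  simp only [Matrix.mul_apply, iotaM_apply, colShear_apply, PadicInt.coe_add, add_mul,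
    Finset.sum_add_distrib]
  congr 1
  · rw [Finset.sum_eq_single k] <;> simp +contextual [eq_comm]
  · rw [Finset.sum_eq_single j] <;> simp +contextual

theorem mul_iotaM_rowShear_apply (j : Fin N) (c : Fin N → ℤ_[p]) (hc : c j = 0)
    (g : Matrix (Fin N) (Fin N) ℚ_[p]) (k l : Fin N) :
    (g * (iotaM p N (rowShear j c hc) : Matrix (Fin N) (Fin N) ℚ_[p])) k l =
      g k l + g k j * (c l : ℚ_[p]) := by
  simp only [Matrix.mul_apply, iotaM_apply, rowShear_apply, PadicInt.coe_add, mul_add,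
    Finset.sum_add_distrib]
  congr 1
  · rw [Finset.sum_eq_single l] <;> simp +contextual [eq_comm]
  · rw [Finset.sum_eq_single j] <;> simp +contextual

/-- The rows and columns of `g` with index in `S` are those of `diag(ϖ^{b_i})`. -/
def IsReducedOn (S : Finset (Fin N)) (b : Fin N → ℤ) (g : GG p N) : Prop :=
  ∀ j ∈ S, ∀ i, (g : Matrix (Fin N) (Fin N) ℚ_[p]) i j = (if i = j then (p : ℚ_[p]) ^ b j else 0) ∧
    (g : Matrix (Fin N) (Fin N) ℚ_[p]) j i = (if i = j then (p : ℚ_[p]) ^ b j else 0)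

theorem exists_pivot {S : Finset (Fin N)} {b : Fin N → ℤ} {g : GG p N} (hg : IsReducedOn S b g)
    {j₀ : Fin N} (hj₀ : j₀ ∉ S) : ∃ i j, i ∉ S ∧ j ∉ S ∧
      (g : Matrix (Fin N) (Fin N) ℚ_[p]) i j ≠ 0 ∧ ∀ k l, k ∉ S → l ∉ S →
        ‖(g : Matrix (Fin N) (Fin N) ℚ_[p]) k l‖ ≤ ‖(g : Matrix (Fin N) (Fin N) ℚ_[p]) i j‖ ∧
        (l < j → ‖(g : Matrix (Fin N) (Fin N) ℚ_[p]) k l‖ <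
          ‖(g : Matrix (Fin N) (Fin N) ℚ_[p]) i j‖) := by
  let f : Fin N × Fin N → ℝ ×ₗ (Fin N)ᵒᵈ := fun x =>
    toLex (‖(g : Matrix (Fin N) (Fin N) ℚ_[p]) x.1 x.2‖, OrderDual.toDual x.2)
  obtain ⟨⟨i, j⟩, ⟨hi, hj⟩, hmax⟩ := Set.exists_max_image {x : Fin N × Fin N | x.1 ∉ S ∧ x.2 ∉ S} f
    (Set.toFinite _) ⟨(j₀, j₀), hj₀, hj₀⟩
  have hle : ∀ k l, k ∉ S → l ∉ S →
        ‖(g : Matrix (Fin N) (Fin N) ℚ_[p]) k l‖ ≤ ‖(g : Matrix (Fin N) (Fin N) ℚ_[p]) i j‖ ∧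
        (l < j → ‖(g : Matrix (Fin N) (Fin N) ℚ_[p]) k l‖ <
          ‖(g : Matrix (Fin N) (Fin N) ℚ_[p]) i j‖) := by
    intro k l hk hl
    rcases Prod.Lex.toLex_le_toLex.1 (hmax (k, l) ⟨hk, hl⟩) with h | ⟨h1, h2⟩
    · exact ⟨le_of_lt h, fun _ => h⟩
    · exact ⟨le_of_eq h1, fun hlt => absurd hlt (not_lt_of_ge h2)⟩
  refine ⟨i, j, hi, hj, fun h0 => ?_, hle⟩
  have hdet : (g : Matrix (Fin N) (Fin N) ℚ_[p]).det = 0 := by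
    refine Matrix.det_eq_zero_of_column_eq_zero j fun k => ?_
    by_cases hk : k ∈ S
    · rw [(hg k hk j).2, if_neg (fun h : j = k => hj (h ▸ hk))]
    · have := (hle k j hk hj).1
      rw [h0, norm_zero] at this
      exact norm_le_zero_iff.1 this
  exact ((Matrix.isUnit_iff_isUnit_det _).1 g.isUnit).ne_zero hdet

theorem exists_reduction_step {S : Finset (Fin N)} {b : Fin N → ℤ} {g : GG p N}
    (hg : IsReducedOn S b g) {j₀ : Fin N} (hj₀ : j₀ ∉ S) :
    ∃ (j : Fin N) (b' : Fin N → ℤ) (m : MM p N) (u : GG p N), j ∉ S ∧ u ∈ I1set p N ∧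
      IsReducedOn (insert j S) b' (iotaM p N m * g * u) := by
  obtain ⟨i, j, hi, hj, h0, hle⟩ := exists_pivot hg hj₀
  have hp0 : (p : ℚ_[p]) ≠ 0 := by exact_mod_cast (Fact.out : p.Prime).ne_zero
  have hjS : ∀ {l}, l ∈ S → l ≠ j := fun hl h => hj (h ▸ hl)
  have hiS : ∀ {l}, l ∈ S → l ≠ i := fun hl h => hi (h ▸ hl)
  set α := (g : Matrix (Fin N) (Fin N) ℚ_[p]) i j with hα
  obtain ⟨ε, hε⟩ : ∃ ε : ℤ_[p]ˣ, ((ε : ℤ_[p]) : ℚ_[p]) * α = (p : ℚ_[p]) ^ α.valuation := by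
    have hn : ‖(p : ℚ_[p]) ^ α.valuation / α‖ = 1 := by
      rw [norm_div, Padic.norm_p_zpow, ← Padic.norm_eq_zpow_neg_valuation h0,
        div_self (norm_ne_zero_iff.2 h0)]
    exact ⟨PadicInt.mkUnits hn, div_mul_cancel₀ _ h0⟩
  set v := α.valuation
  have hεn : ‖((ε : ℤ_[p]) : ℚ_[p])‖ = 1 := PadicInt.isUnit_iff.1 ε.isUnit
  -- swap rows and normalise the pivot
  let m₁ : MM p N := diagHom N ℤ_[p] (Function.update (1 : Fin N → ℤ_[p]ˣ) j ε) *
    permHom N ℤ_[p] (Equiv.swap i j)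
  set g₁ : GG p N := iotaM p N m₁ * g with hg₁
  have e₁ : ∀ k l, (g₁ : Matrix (Fin N) (Fin N) ℚ_[p]) k l =
      (((Function.update (1 : Fin N → ℤ_[p]ˣ) j ε k : ℤ_[p]ˣ) : ℤ_[p]) : ℚ_[p]) *
        (g : Matrix (Fin N) (Fin N) ℚ_[p]) (Equiv.swap i j k) l := by
    intro k l
    have hd : iotaM p N (diagHom N ℤ_[p] (Function.update (1 : Fin N → ℤ_[p]ˣ) j ε)) =
        diagHom N ℚ_[p] (fun k => Units.map PadicInt.Coe.ringHom.toMonoidHom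
          (Function.update (1 : Fin N → ℤ_[p]ˣ) j ε k)) := by
      refine Matrix.GeneralLinearGroup.ext fun k l => ?_
      rw [iotaM_apply, diagHom_val, diagHom_val, Matrix.diagonal_apply, Matrix.diagonal_apply]
      split_ifs <;> rfl
    rw [hg₁, map_mul, mul_assoc, hd, iotaM_permHom, Units.val_mul, diagHom_mul_apply, Units.val_mul,
      permHom_mul_apply, Equiv.swap_inv]
    rfl
  have e₁j : ∀ l, (g₁ : Matrix (Fin N) (Fin N) ℚ_[p]) j l =
      ((ε : ℤ_[p]) : ℚ_[p]) * (g : Matrix (Fin N) (Fin N) ℚ_[p]) i l := fun l => by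
    rw [e₁, Function.update_self, Equiv.swap_apply_right]
  have e₁ne : ∀ k l, k ≠ j → (g₁ : Matrix (Fin N) (Fin N) ℚ_[p]) k l =
      (g : Matrix (Fin N) (Fin N) ℚ_[p]) (Equiv.swap i j k) l := fun k l hk => by
    rw [e₁, Function.update_of_ne hk, Pi.one_apply, Units.val_one, PadicInt.coe_one, one_mul]
  have hswap : ∀ {k}, k ∉ S → Equiv.swap i j k ∉ S := by
    intro k hk
    rw [Equiv.swap_apply_def]
    split_ifs <;> assumption
  have hred₁ : IsReducedOn S b g₁ := by
    intro l hl k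
    constructor
    · by_cases hk : k = j
      · subst hk
        rw [e₁j, (hg l hl i).1, if_neg (hiS hl).symm, if_neg (hjS hl).symm, mul_zero]
      · rw [e₁ne k l hk, (hg l hl _).1]
        refine if_congr ?_ rfl rfl
        rw [Equiv.swap_apply_eq_iff, Equiv.swap_apply_of_ne_of_ne (hiS hl) (hjS hl)]
    · rw [e₁ne l k (hjS hl), Equiv.swap_apply_of_ne_of_ne (hiS hl) (hjS hl), (hg l hl k).2]
  have hnα : ‖α‖ = ‖(p : ℚ_[p]) ^ v‖ := by rw [← hε, norm_mul, hεn, one_mul]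
  have hjj₁ : (g₁ : Matrix (Fin N) (Fin N) ℚ_[p]) j j = (p : ℚ_[p]) ^ v := by rw [e₁j, hε]
  have hv0 : (p : ℚ_[p]) ^ v ≠ 0 := zpow_ne_zero _ hp0
  have hcol : ∀ k, k ∉ S → ‖(g₁ : Matrix (Fin N) (Fin N) ℚ_[p]) k j‖ ≤ ‖(p : ℚ_[p]) ^ v‖ := by
    intro k hk
    by_cases hkj : k = j
    · rw [hkj, hjj₁]
    · rw [e₁ne k j hkj, ← hnα]
      exact (hle _ _ (hswap hk) hj).1
  have hrow : ∀ l, l ∉ S →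
      ‖(g₁ : Matrix (Fin N) (Fin N) ℚ_[p]) j l‖ ≤ ‖(p : ℚ_[p]) ^ v‖ ∧
      (l < j → ‖(g₁ : Matrix (Fin N) (Fin N) ℚ_[p]) j l‖ < ‖(p : ℚ_[p]) ^ v‖) := by
    intro l hl
    rw [e₁j, norm_mul, hεn, one_mul, ← hnα]
    exact hle i l hi hl
  -- clear the column of the pivot
  obtain ⟨c, hc⟩ : ∃ c : Fin N → ℤ_[p], ∀ k, (c k : ℚ_[p]) =
      if k = j then 0 else -(g₁ : Matrix (Fin N) (Fin N) ℚ_[p]) k j / (p : ℚ_[p]) ^ v := by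
    refine ⟨fun k => ⟨if k = j then 0 else -(g₁ : Matrix (Fin N) (Fin N) ℚ_[p]) k j / (p : ℚ_[p]) ^ v,
      ?_⟩, fun k => rfl⟩
    split_ifs with hk
    · simp
    · rw [norm_div, norm_neg]
      refine div_le_one_of_le₀ ?_ (norm_nonneg _)
      by_cases hkS : k ∈ S
      · rw [(hred₁ k hkS j).2, if_neg (hjS hkS).symm, norm_zero]
        exact norm_nonneg _
      · exact hcol k hkS
  have hcj : c j = 0 := Subtype.ext (by rw [hc, if_pos rfl]; rfl)
  set g₂ : GG p N := iotaM p N (colShear j c hcj) * g₁ with hg₂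
  have e₂ : ∀ k l, (g₂ : Matrix (Fin N) (Fin N) ℚ_[p]) k l =
      (g₁ : Matrix (Fin N) (Fin N) ℚ_[p]) k l +
        (c k : ℚ_[p]) * (g₁ : Matrix (Fin N) (Fin N) ℚ_[p]) j l := fun k l => by
    rw [hg₂, Units.val_mul, iotaM_colShear_mul_apply]
  have e₂j : ∀ l, (g₂ : Matrix (Fin N) (Fin N) ℚ_[p]) j l =
      (g₁ : Matrix (Fin N) (Fin N) ℚ_[p]) j l := fun l => by
    rw [e₂, hcj, PadicInt.coe_zero, zero_mul, add_zero]
  have hcol₂ : ∀ k, k ≠ j → (g₂ : Matrix (Fin N) (Fin N) ℚ_[p]) k j = 0 := fun k hk => by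
    rw [e₂, hc, if_neg hk, hjj₁, div_mul_cancel₀ _ hv0, add_neg_cancel]
  have hred₂ : IsReducedOn S b g₂ := by
    intro l hl k
    constructor
    · rw [e₂, (hred₁ l hl j).1, if_neg (hjS hl).symm, mul_zero, add_zero, (hred₁ l hl k).1]
    · rw [e₂, hc, if_neg (hjS hl), (hred₁ l hl j).2, if_neg (hjS hl).symm, neg_zero, zero_div,
        zero_mul, add_zero, (hred₁ l hl k).2]
  -- clear the row of the pivot
  obtain ⟨y, hy⟩ : ∃ y : Fin N → ℤ_[p], ∀ l, (y l : ℚ_[p]) =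
      if l = j then 0 else -(g₁ : Matrix (Fin N) (Fin N) ℚ_[p]) j l / (p : ℚ_[p]) ^ v := by
    refine ⟨fun l => ⟨if l = j then 0 else -(g₁ : Matrix (Fin N) (Fin N) ℚ_[p]) j l / (p : ℚ_[p]) ^ v,
      ?_⟩, fun l => rfl⟩
    split_ifs with hl
    · simp
    · rw [norm_div, norm_neg]
      refine div_le_one_of_le₀ ?_ (norm_nonneg _)
      by_cases hlS : l ∈ S
      · rw [(hred₁ l hlS j).1, if_neg (hjS hlS).symm, norm_zero]
        exact norm_nonneg _
      · exact (hrow l hlS).1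
  have hyj : y j = 0 := Subtype.ext (by rw [hy, if_pos rfl]; rfl)
  have hylt : ∀ l, l < j → ‖(y l : ℚ_[p])‖ < 1 := by
    intro l hl
    rw [hy, if_neg hl.ne, norm_div, norm_neg, div_lt_one (norm_pos_iff.2 hv0)]
    by_cases hlS : l ∈ S
    · rw [(hred₁ l hlS j).1, if_neg (hjS hlS).symm, norm_zero]
      exact norm_pos_iff.2 hv0
    · exact (hrow l hlS).2 hl
  have huI : iotaM p N (rowShear j y hyj) ∈ I1set p N := by
    refine mem_I1set_iff.2 ⟨mem_Iset_iff.2 ⟨⟨_, rfl⟩, fun k l hkl => ?_⟩, fun k => ?_⟩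
    · rw [iotaM_apply, rowShear_apply, if_neg hkl.ne, zero_add]
      split_ifs with hk
      · exact hylt l (hk ▸ hkl)
      · simp
    · rw [iotaM_apply, rowShear_apply, if_pos rfl]
      split_ifs with hk
      · simp [hk, hyj]
      · simp
  refine ⟨j, Function.update b j v, colShear j c hcj * m₁, _, hj, huI, ?_⟩
  rw [map_mul, mul_assoc (iotaM p N _), ← hg₁, ← hg₂]
  have e₃ : ∀ k l, ((g₂ * iotaM p N (rowShear j y hyj) : GG p N) :
      Matrix (Fin N) (Fin N) ℚ_[p]) k l = (g₂ : Matrix (Fin N) (Fin N) ℚ_[p]) k l +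
        (g₂ : Matrix (Fin N) (Fin N) ℚ_[p]) k j * (y l : ℚ_[p]) := fun k l => by
    rw [Units.val_mul, mul_iotaM_rowShear_apply]
  intro l hl k
  rw [Finset.mem_insert] at hl
  rw [e₃, e₃]
  rcases hl with rfl | hl
  · rw [Function.update_self]
    by_cases hk : k = l
    · subst hk
      rw [e₂j, hjj₁, hyj, PadicInt.coe_zero, mul_zero, add_zero, if_pos rfl]
      exact ⟨rfl, rfl⟩
    · rw [hcol₂ k hk, e₂j, e₂j, hjj₁, hy k, if_neg hk, zero_mul, add_zero, if_neg hk,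
        mul_div_cancel₀ _ hv0, add_neg_cancel]
      exact ⟨rfl, rfl⟩
  · rw [Function.update_of_ne (hjS hl), hcol₂ l (hjS hl), zero_mul, add_zero, (hred₂ l hl k).2,
      hy l, if_neg (hjS hl), (hred₁ l hl j).1, if_neg (hjS hl).symm, neg_zero, zero_div, mul_zero,
      add_zero, (hred₂ l hl k).1]
    exact ⟨rfl, rfl⟩

theorem exists_piDiag_eq (g : GG p N) : ∃ (m : MM p N) (u : GG p N) (b : Fin N → ℤ),
    u ∈ I1set p N ∧ iotaM p N m * g * u = piDiag p b := by
  have key : ∀ d ≤ N, ∃ (S : Finset (Fin N)) (m : MM p N) (u : GG p N) (b : Fin N → ℤ),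
      S.card = d ∧ u ∈ I1set p N ∧ IsReducedOn S b (iotaM p N m * g * u) := by
    intro d
    induction d with
    | zero => exact fun _ => ⟨∅, 1, 1, 0, rfl, mem_I1grp.1 (one_mem _), by simp [IsReducedOn]⟩
    | succ d ih =>
      intro hd
      obtain ⟨S, m, u, b, hS, hu, hred⟩ := ih (by omega)
      obtain ⟨j₀, hj₀⟩ : ∃ j₀, j₀ ∉ S := by
        by_contra! h
        rw [Finset.eq_univ_iff_forall.2 h, Finset.card_univ, Fintype.card_fin] at hS
        omega
      obtain ⟨j, b', m', u', hj, hu', hred'⟩ := exists_reduction_step hred hj₀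
      refine ⟨insert j S, m' * m, u * u', b', by rw [Finset.card_insert_of_notMem hj, hS],
        mem_I1grp.1 (mul_mem (mem_I1grp.2 hu) (mem_I1grp.2 hu')), ?_⟩
      simpa only [map_mul, mul_assoc] using hred'
  obtain ⟨S, m, u, b, hS, hu, hred⟩ := key N le_rfl
  refine ⟨m, u, b, hu, Matrix.GeneralLinearGroup.ext fun i j => ?_⟩
  have hj : j ∈ S := by
    rw [(Finset.card_eq_iff_eq_univ S).1 (by simpa using hS)]
    exact Finset.mem_univ j
  rw [(hred j hj i).1, piDiag, diagHom_val, Matrix.diagonal_apply]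
  split_ifs with h
  · rw [h, Units.val_zpow_eq_zpow_val]
    rfl
  · rfl

theorem exists_decomposition (hN : 0 < N) (g : GG p N) :
    ∃ (n : ℤ) (m : MM p N) (σ : Equiv.Perm (Fin N)) (a : Fin (N - 1) → ℤ) (u : GG p N),
      a ∈ Sset p N σ ∧ u ∈ I1set p N ∧ g = piSc p N n * iotaM p N m * wS p N σ a * u := by
  obtain ⟨m, u, b, hu, h⟩ := exists_piDiag_eq g
  let i₀ : Fin N := ⟨N - 1, by omega⟩
  let a : Fin (N - 1) → ℤ := fun i => b ⟨i, by omega⟩ - b i₀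
  obtain ⟨σ, hσ⟩ := exists_mem_Sset (p := p) a
  have hb : piDiag p b = piSc p N (b i₀) * tGL p N a := by
    rw [piSc_eq, tGL_eq, piDiag_mul]
    refine congrArg _ (funext fun i => ?_)
    rw [Pi.add_apply]
    by_cases hi : (i : ℕ) < N - 1
    · rw [expo_of_lt a hi]
      simp [a]
    · have : i = i₀ := Fin.ext (by simp only [i₀]; omega)
      rw [expo_of_not_lt a hi, this, add_zero]
  refine ⟨b i₀, m⁻¹ * (permHom N ℤ_[p] σ)⁻¹, σ, a, u⁻¹, hσ,
    mem_I1grp.1 (inv_mem (mem_I1grp.2 hu)), ?_⟩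
  have h1 : g = (iotaM p N m)⁻¹ * piDiag p b * u⁻¹ := by
    rw [← h]
    group
  rw [h1, hb, wS_eq, ← mul_assoc, ← piSc_comm, map_mul, map_inv, map_inv]
  group

end Decomposition

section FixedVectors

variable {p : ℕ} [Fact p.Prime] {N : ℕ}

theorem exists_unip_lift {u : Gk p N} (hu : u ∈ unip N (ZMod p) (· < ·)) :
    ∃ m : MM p N, redM p N m = u ∧ (∀ i, (m : Matrix (Fin N) (Fin N) ℤ_[p]) i i = 1) ∧
      ∀ i j, j < i → (m : Matrix (Fin N) (Fin N) ℤ_[p]) i j = 0 := by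
  obtain ⟨hdiag, hlow⟩ := mem_unip.1 hu
  choose s hs using ZMod.ringHom_surjective (PadicInt.toZMod (p := p))
  let M : Matrix (Fin N) (Fin N) ℤ_[p] := Matrix.of fun i j =>
    if i = j then 1 else if i < j then s ((u : Matrix (Fin N) (Fin N) (ZMod p)) i j) else 0
  have hM : ∀ i j, M i j = if i = j then 1 else
    if i < j then s ((u : Matrix (Fin N) (Fin N) (ZMod p)) i j) else 0 := fun _ _ => rfl
  have hlowM : ∀ i j, j < i → M i j = 0 := fun i j h => by
    rw [hM, if_neg h.ne', if_neg h.not_gt]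
  have hdet : M.det = 1 := by
    rw [Matrix.det_of_isUpperTriangular (fun i j h => hlowM i j h)]
    simp [hM]
  refine ⟨GeneralLinearGroup.mk'' M (hdet ▸ isUnit_one), ?_, fun i => by
    change M i i = 1
    rw [hM, if_pos rfl], hlowM⟩
  refine Matrix.GeneralLinearGroup.ext fun i j => ?_
  rw [redM_apply]
  change PadicInt.toZMod (M i j) = _
  rw [hM]
  split_ifs with h1 h2
  · rw [h1, hdiag, map_one]
  · exact hs _
  · rw [hlow i j h1 h2, map_zero]

theorem conj_unip_lift_mem_I1set {σ : Equiv.Perm (Fin N)} {a : Fin (N - 1) → ℤ}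
    (ha : a ∈ Sset p N σ) {m : MM p N} (hdiag : ∀ i, (m : Matrix (Fin N) (Fin N) ℤ_[p]) i i = 1)
    (hlow : ∀ i j, j < i → (m : Matrix (Fin N) (Fin N) ℤ_[p]) i j = 0) :
    (wS p N σ a)⁻¹ * iotaM p N m * wS p N σ a ∈ I1set p N := by
  have hp1 := one_lt_prime_real (p := p)
  have h0 : (p : ℝ) ≠ 0 := (zero_lt_one.trans hp1).ne'
  set g := (wS p N σ a)⁻¹ * iotaM p N m * wS p N σ a with hg
  have hgm : wS p N σ a * g * (wS p N σ a)⁻¹ = iotaM p N m := by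
    rw [hg]
    group
  have hgd : ∀ i, (g : Matrix (Fin N) (Fin N) ℚ_[p]) i i = 1 := by
    intro i
    have h := wS_conj_apply σ a g i i
    rw [hgm, iotaM_apply, hdiag, mul_right_comm, ← Units.val_mul, ← _root_.zpow_add,
      add_neg_cancel, zpow_zero, Units.val_one, one_mul] at h
    rw [← h, PadicInt.coe_one]
  have hle : ∀ i j, i ≠ j → ‖(g : Matrix (Fin N) (Fin N) ℚ_[p]) i j‖ ≤ 1 ∧
      (j < i → ‖(g : Matrix (Fin N) (Fin N) ℚ_[p]) i j‖ < 1) := by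
    intro i j hij
    have h : ‖(g : Matrix (Fin N) (Fin N) ℚ_[p]) i j‖ =
        ‖(m : Matrix (Fin N) (Fin N) ℤ_[p]) (σ i) (σ j)‖ *
          (p : ℝ) ^ (expo N a i - expo N a j) := by
      have h := norm_wS_conj_apply σ a g i j
      rw [hgm, iotaM_apply, PadicInt.padic_norm_e_of_padicInt] at h
      rw [h, mul_assoc, ← zpow_add₀ h0, sub_add_sub_cancel', sub_self, zpow_zero, mul_one]
    rcases lt_or_gt_of_ne ((lexKey_injective (expo N a)).ne hij) with hk | hk
    · have hm1 := (m : Matrix (Fin N) (Fin N) ℤ_[p]) (σ i) (σ j) |>.norm_le_one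
      rcases lexKey_lt_iff.1 hk with hlt | ⟨heq, hlt⟩
      · have hlt1 : ‖(g : Matrix (Fin N) (Fin N) ℚ_[p]) i j‖ < 1 := by
          rw [h]
          exact mul_lt_one_of_nonneg_of_lt_one_right hm1 (zpow_nonneg (by positivity) _)
            (zpow_lt_one_of_neg₀ hp1 (by omega))
        exact ⟨hlt1.le, fun _ => hlt1⟩
      · rw [h, heq, sub_self, zpow_zero, mul_one]
        exact ⟨hm1, fun hji => absurd hji hlt.not_gt⟩
    · rw [h, hlow _ _ (mem_Sset_iff.1 ha j i hk), norm_zero, zero_mul]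
      exact ⟨zero_le_one, fun _ => zero_lt_one⟩
  refine mem_I1set_iff.2 ⟨mem_Iset_iff.2 ⟨mem_Kset_iff.2 ⟨fun i j => ?_, ?_⟩,
    fun i j hij => (hle i j hij.ne').2 hij⟩, fun i => by rw [hgd, sub_self, norm_zero]; exact one_pos⟩
  · by_cases hij : i = j
    · rw [hij, hgd, norm_one]
    · exact (hle i j hij).1
  · rw [← norm_det_iotaM m, hg, Units.val_mul, Units.val_mul, Matrix.det_units_conj']

/-- A function supported in finitely many cosets `KZ g` vanishes at all but
finitely many of the elements `ω t_a`. -/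
theorem finite_ne_zero (hN : 0 < N) {W : Type*} [Zero W] {f : GG p N → W}
    {S : Finset (GG p N)}
    (hS : ∀ g, f g ≠ 0 → ∃ s ∈ S, ∃ (n : ℤ) (m : MM p N), g = piSc p N n * iotaM p N m * s) :
    {x : Equiv.Perm (Fin N) × (Fin (N - 1) → ℤ) | f (wS p N x.1 x.2) ≠ 0}.Finite := by
  set T := {x : Equiv.Perm (Fin N) × (Fin (N - 1) → ℤ) | f (wS p N x.1 x.2) ≠ 0}
  choose! s hs n m hsm using hS
  refine Set.Finite.of_finite_image (f := fun x => (x.1, s (wS p N x.1 x.2)))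
    ((Set.finite_univ.prod S.finite_toSet).subset ?_) ?_
  · rintro _ ⟨x, hx, rfl⟩
    exact ⟨Set.mem_univ _, hs _ hx⟩
  · rintro ⟨σ, a⟩ hx ⟨τ, b⟩ hy hxy
    obtain ⟨rfl, h⟩ := Prod.mk.inj hxy
    have h1 : ∀ {x}, x ∈ T → s (wS p N x.1 x.2) = piSc p N (-n (wS p N x.1 x.2)) *
        iotaM p N (m (wS p N x.1 x.2))⁻¹ * wS p N x.1 x.2 * 1 := by
      intro x hx
      conv_rhs => rw [mul_one, piSc_comm, mul_assoc, piSc_neg, map_inv]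
      rw [eq_inv_mul_iff_mul_eq, eq_inv_mul_iff_mul_eq, ← mul_assoc]
      exact (hsm _ hx).symm
    have h2 := (h1 hx).symm.trans (h.trans (h1 hy))
    have h1mem : (1 : GG p N) ∈ I1set p N := mem_I1grp.1 (one_mem _)
    exact Prod.ext rfl (eq_of_coset_eq hN h1mem h1mem h2).2

variable {V : Type} [AddCommGroup V] [Module (kb p) V] {ρ : Representation (kb p) (Gk p N) V}

/-- Left equivariance under `KZ`, with `ϖ` acting trivially on `V`. -/
def IsKZEquivariant (ρ : Representation (kb p) (Gk p N) V) (f : GG p N → V) : Prop :=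
  ∀ (n : ℤ) (m : MM p N) (g : GG p N),
    f (piSc p N n * iotaM p N m * g) = ρ (redM p N m) (f g)

theorem IsKZEquivariant.iotaM_mul {f : GG p N → V} (hf : IsKZEquivariant ρ f) (m : MM p N)
    (g : GG p N) : f (iotaM p N m * g) = ρ (redM p N m) (f g) := by
  simpa [piSc_zero] using hf 0 m g

theorem IsKZEquivariant.unip_fixed {f : GG p N → V} (hf : IsKZEquivariant ρ f)
    (hinv : IsI1Inv p N f) {σ : Equiv.Perm (Fin N)} {a : Fin (N - 1) → ℤ}
    (ha : a ∈ Sset p N σ) {u : Gk p N} (hu : u ∈ unip N (ZMod p) (· < ·)) :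
    ρ u (f (wS p N σ a)) = f (wS p N σ a) := by
  obtain ⟨m, rfl, hdiag, hlow⟩ := exists_unip_lift hu
  rw [← hf.iotaM_mul, ← hinv _ (conj_unip_lift_mem_I1set ha hdiag hlow) (wS p N σ a)]
  group

theorem IsKZEquivariant.ext (hN : 0 < N) {f f' : GG p N → V} (hf : IsKZEquivariant ρ f)
    (hinv : IsI1Inv p N f) (hf' : IsKZEquivariant ρ f') (hinv' : IsI1Inv p N f')
    (h : ∀ σ a, a ∈ Sset p N σ → f (wS p N σ a) = f' (wS p N σ a)) : f = f' := by
  funext g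
  obtain ⟨n, m, σ, a, u, ha, hu, rfl⟩ := exists_decomposition hN g
  rw [hinv u hu, hinv' u hu, hf, hf', h σ a ha]

theorem IsStd.apply_wS (hN : 0 < N) {v₀ : V} {σ τ : Equiv.Perm (Fin N)} {a b : Fin (N - 1) → ℤ}
    {f : GG p N → V} (hf : IsStd p N ρ v₀ σ a f) (ha : a ∈ Sset p N σ) (hb : b ∈ Sset p N τ) :
    f (wS p N τ b) = if (σ, a) = (τ, b) then v₀ else 0 := by
  split_ifs with h
  · obtain ⟨rfl, rfl⟩ := Prod.mk.inj h
    exact hf.2.2.2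
  · by_contra h0
    obtain ⟨n, m, u, hu, he⟩ := hf.2.2.1 _ h0
    have h1 : piSc p N 0 * iotaM p N 1 * wS p N τ b * 1 =
        piSc p N n * iotaM p N (m * (permHom N ℤ_[p] σ)⁻¹) * wS p N σ a * u := by
      rw [piSc_zero, map_one, one_mul, one_mul, mul_one, he, wS_eq, map_mul, map_inv]
      group
    obtain rfl := (eq_of_coset_eq hN (mem_I1grp.1 (one_mem _)) hu h1).2
    exact h (by rw [Sset_unique ha hb])

end FixedVectors

/-- the functions `f_{ω,a}` exist, are unique, and form a basis of
`(ind_{KZ}^G σ)^{I_1}`. -/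
theorem stmt8 (p : ℕ) [Fact p.Prime] (n : ℕ)
    {V : Type} [AddCommGroup V] [Module (kb p) V] [FiniteDimensional (kb p) V]
    (ρ : Representation (kb p) (Gk p (n + 3)) V) (hirr : IsIrred p (n + 3) ρ)
    (v₀ : V) (hv₀ : v₀ ≠ 0)
    (hfix : ∀ m ∈ I1pre p (n + 3), ρ (redM p (n + 3) m) v₀ = v₀) :
    (∀ (ω : Equiv.Perm (Fin (n + 3))) (a : Fin (n + 2) → ℤ), a ∈ Sset p (n + 3) ω →
      ∃! f : GG p (n + 3) → V, IsStd p (n + 3) ρ v₀ ω a f) ∧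
    (∀ Φ : Equiv.Perm (Fin (n + 3)) × (Fin (n + 2) → ℤ) → (GG p (n + 3) → V),
      (∀ (ω : Equiv.Perm (Fin (n + 3))) (a : Fin (n + 2) → ℤ), a ∈ Sset p (n + 3) ω →
        IsStd p (n + 3) ρ v₀ ω a (Φ (ω, a))) →
      ∀ f : GG p (n + 3) → V, IndMem p (n + 3) ρ f → IsI1Inv p (n + 3) f →
        ∃! c : (Equiv.Perm (Fin (n + 3)) × (Fin (n + 2) → ℤ)) →₀ kb p,
          (∀ x ∈ c.support, x.2 ∈ Sset p (n + 3) x.1) ∧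
          f = fun g => ∑ x ∈ c.support, c x • Φ x g) := by
  have hN : 0 < n + 3 := by omega
  have hequiv : ∀ {ω a f}, IsStd p (n + 3) ρ v₀ ω a f → IsKZEquivariant ρ f := fun h => h.1.1
  have hunip : ∀ u ∈ unip (n + 3) (ZMod p) (· < ·), ρ u v₀ = v₀ := by
    intro u hu
    obtain ⟨m, rfl, -⟩ := exists_unip_lift hu
    exact hfix m (mem_I1pre_iff.2 hu)
  refine ⟨fun ω a ha => ⟨stdFun ρ v₀ ω a, isStd_stdFun hN hfix ha, fun f hf => ?_⟩,
    fun Φ hΦ f hf hinv => ?_⟩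
  · have h := isStd_stdFun (ρ := ρ) hN hfix ha
    refine (hequiv hf).ext hN hf.2.1 (hequiv h) h.2.1 fun τ b hb => ?_
    rw [hf.apply_wS hN ha hb, h.apply_wS hN ha hb]
  classical
  have hcoef : ∀ ω a, a ∈ Sset p (n + 3) ω → ∃ c : kb p, f (wS p (n + 3) ω a) = c • v₀ :=
    fun ω a ha => exists_smul_of_fixed (n := n + 2) hirr.2 hv₀ hunip
      fun u hu => IsKZEquivariant.unip_fixed hf.1 hinv ha hu
  choose! c₀ hc₀ using hcoef
  have heval : ∀ c : (Equiv.Perm (Fin (n + 3)) × (Fin (n + 2) → ℤ)) →₀ kb p,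
      (∀ x ∈ c.support, x.2 ∈ Sset p (n + 3) x.1) → ∀ ω a, a ∈ Sset p (n + 3) ω →
        ∑ x ∈ c.support, c x • Φ x (wS p (n + 3) ω a) = c (ω, a) • v₀ := by
    intro c hc ω a ha
    have h : ∀ x ∈ c.support, c x • Φ x (wS p (n + 3) ω a) =
        if x = (ω, a) then c x • v₀ else 0 := by
      intro x hx
      rw [(hΦ x.1 x.2 (hc x hx)).apply_wS hN (hc x hx) ha, smul_ite, smul_zero]
      rfl
    rw [Finset.sum_congr rfl h, Finset.sum_ite_eq']
    split_ifs with hmem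
    · rfl
    · rw [Finsupp.notMem_support_iff.1 hmem, zero_smul]
  obtain ⟨S, hS⟩ := hf.2.1
  let c : (Equiv.Perm (Fin (n + 3)) × (Fin (n + 2) → ℤ)) →₀ kb p :=
    Finsupp.ofSupportFinite
      (fun x => if x.2 ∈ Sset p (n + 3) x.1 then c₀ x.1 x.2 else 0) <| by
        refine (finite_ne_zero hN hS).subset fun x hx => ?_
        obtain ⟨hxS, hx0⟩ := ite_ne_right_iff.1 (Function.mem_support.1 hx)
        change f (wS p (n + 3) x.1 x.2) ≠ 0
        rw [hc₀ x.1 x.2 hxS]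
        exact smul_ne_zero hx0 hv₀
  have hc : ∀ x, c x = if x.2 ∈ Sset p (n + 3) x.1 then c₀ x.1 x.2 else 0 := fun _ => rfl
  have hcS : ∀ x ∈ c.support, x.2 ∈ Sset p (n + 3) x.1 := by
    intro x hx
    rw [Finsupp.mem_support_iff, hc] at hx
    exact (ite_ne_right_iff.1 hx).1
  refine ⟨c, ⟨hcS, ?_⟩, ?_⟩
  · refine IsKZEquivariant.ext hN hf.1 hinv (fun k m g => ?_) (fun u hu g => ?_) fun ω a ha => ?_
    · rw [map_sum]
      refine Finset.sum_congr rfl fun x hx => ?_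
      rw [hequiv (hΦ x.1 x.2 (hcS x hx)), map_smul]
    · refine Finset.sum_congr rfl fun x hx => ?_
      rw [(hΦ x.1 x.2 (hcS x hx)).2.1 u hu]
    · rw [heval c hcS ω a ha, hc₀ ω a ha, hc, if_pos ha]
  · rintro d ⟨hdS, hfd⟩
    ext ⟨ω, a⟩
    by_cases ha : a ∈ Sset p (n + 3) ω
    · refine smul_left_injective _ hv₀ ?_
      change d (ω, a) • v₀ = c (ω, a) • v₀
      rw [← heval d hdS ω a ha, ← congrFun hfd (wS p (n + 3) ω a), hc₀ ω a ha, hc, if_pos ha]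
    · have hd0 : d (ω, a) = 0 := Finsupp.notMem_support_iff.1 fun h => ha (hdS (ω, a) h)
      rw [hd0, hc, if_neg ha]

end IH
end
end

section
/- For every ω ∈ W_0, every a ∈ S_ω and every i ∈ I, one has i·f_{ω,a} = χ_σ^ω(i)·f_{ω,a}, i.e. the Iwahori subgroup I acts on the function f_{ω,a} through the conjugate character χ_σ^ω. -/
open Matrix

noncomputable section

namespace IH

variable (p : ℕ) [Fact p.Prime]

variable (N : ℕ)

section Iwahori

/-- The diagonal element of `GL_N(O_F)` with given unit entries. -/
def diagM (d : Fin N → ℤ_[p]ˣ) : MM p N :=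
  Units.map (Matrix.diagonalRingHom (Fin N) ℤ_[p]).toMonoidHom (MulEquiv.piUnits.symm d)

/-- The permutation matrix of `σ`, as an element of `GL_N(O_F)`. -/
def permM (σ : Equiv.Perm (Fin N)) : MM p N where
  val := (σ⁻¹).permMatrix ℤ_[p]
  inv := σ.permMatrix ℤ_[p]
  val_inv := by rw [← Matrix.permMatrix_mul, mul_inv_cancel, Matrix.permMatrix_one]
  inv_val := by rw [← Matrix.permMatrix_mul, inv_mul_cancel, Matrix.permMatrix_one]

variable {p N}

theorem coe_diagM (d : Fin N → ℤ_[p]ˣ) :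
    (diagM p N d : Matrix (Fin N) (Fin N) ℤ_[p]) = Matrix.diagonal fun i => (d i : ℤ_[p]) := rfl

theorem diagM_inv (d : Fin N → ℤ_[p]ˣ) : (diagM p N d)⁻¹ = diagM p N d⁻¹ := by
  simp only [diagM, map_inv]

theorem coe_redM (m : MM p N) :
    (redM p N m : Matrix (Fin N) (Fin N) (ZMod p)) =
      (m : Matrix (Fin N) (Fin N) ℤ_[p]).map PadicInt.toZMod := rfl

theorem coe_iotaM (m : MM p N) :
    (iotaM p N m : Matrix (Fin N) (Fin N) ℚ_[p]) =
      (m : Matrix (Fin N) (Fin N) ℤ_[p]).map PadicInt.Coe.ringHom := rfl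

theorem coe_redM_diagM (d : Fin N → ℤ_[p]ˣ) :
    (redM p N (diagM p N d) : Matrix (Fin N) (Fin N) (ZMod p)) =
      Matrix.diagonal fun i => PadicInt.toZMod (d i : ℤ_[p]) := by
  rw [coe_redM, coe_diagM, Matrix.diagonal_map (map_zero _)]

theorem coe_iotaM_diagM (d : Fin N → ℤ_[p]ˣ) :
    (iotaM p N (diagM p N d) : Matrix (Fin N) (Fin N) ℚ_[p]) =
      Matrix.diagonal fun i => ((d i : ℤ_[p]) : ℚ_[p]) := by
  rw [coe_iotaM, coe_diagM, Matrix.diagonal_map (map_zero _)]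
  rfl

theorem iotaM_permM (σ : Equiv.Perm (Fin N)) : iotaM p N (permM p N σ) = permGL p N σ := by
  ext i j
  simp [coe_iotaM, permM, permGL, Equiv.Perm.permMatrix, PEquiv.toMatrix_apply, apply_ite]

theorem tGL_mul_iotaM_diagM (a : Fin (N - 1) → ℤ) (d : Fin N → ℤ_[p]ˣ) :
    tGL p N a * iotaM p N (diagM p N d) = iotaM p N (diagM p N d) * tGL p N a := by
  ext1
  simp only [Units.val_mul, coe_iotaM_diagM, tGL, diagGL, Matrix.diagonal_mul_diagonal, mul_comm]

theorem permGL_mul_iotaM_diagM (σ : Equiv.Perm (Fin N)) (d : Fin N → ℤ_[p]ˣ) :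
    permGL p N σ * iotaM p N (diagM p N d) =
      iotaM p N (diagM p N (d ∘ ⇑σ⁻¹)) * permGL p N σ := by
  ext i j
  simp only [Units.val_mul, coe_iotaM_diagM, Matrix.mul_diagonal, Matrix.diagonal_mul, permGL,
    Equiv.Perm.permMatrix, PEquiv.toMatrix_apply, Equiv.toPEquiv_apply, Function.comp_apply]
  by_cases h : σ⁻¹ i = j
  · simp [← h]
  · rw [Equiv.Perm.inv_def] at h
    simp [h]

theorem wS_mul_iotaM_diagM (σ : Equiv.Perm (Fin N)) (a : Fin (N - 1) → ℤ)
    (d : Fin N → ℤ_[p]ˣ) :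
    wS p N σ a * iotaM p N (diagM p N d) =
      iotaM p N (diagM p N (d ∘ ⇑σ⁻¹)) * wS p N σ a := by
  rw [wS, mul_assoc, tGL_mul_iotaM_diagM, ← mul_assoc, permGL_mul_iotaM_diagM, mul_assoc]

theorem diagM_mem_Ipre (d : Fin N → ℤ_[p]ˣ) : diagM p N d ∈ Ipre p N := by
  intro i j hij
  rw [coe_redM_diagM, Matrix.diagonal_apply_ne' _ hij.ne]

theorem toZMod_inv_mul (u : ℤ_[p]ˣ) :
    PadicInt.toZMod ((u⁻¹ : ℤ_[p]ˣ) : ℤ_[p]) * PadicInt.toZMod (u : ℤ_[p]) = 1 := by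
  rw [← map_mul, Units.inv_mul, map_one]

theorem diagM_inv_mul_mul_mem_I1pre (d : Fin N → ℤ_[p]ˣ) {m : MM p N} (hm : m ∈ I1pre p N) :
    (diagM p N d)⁻¹ * m * diagM p N d ∈ I1pre p N := by
  have key (i j : Fin N) : (redM p N ((diagM p N d)⁻¹ * m * diagM p N d) :
      Matrix (Fin N) (Fin N) (ZMod p)) i j = PadicInt.toZMod (((d i)⁻¹ : ℤ_[p]ˣ) : ℤ_[p]) *
        (redM p N m : Matrix (Fin N) (Fin N) (ZMod p)) i j * PadicInt.toZMod (d j : ℤ_[p]) := by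
    rw [diagM_inv, map_mul, map_mul, Units.val_mul, Units.val_mul, coe_redM_diagM,
      coe_redM_diagM, Matrix.mul_diagonal, Matrix.diagonal_mul, Pi.inv_apply]
  refine ⟨fun i j hij => ?_, fun i => ?_⟩
  · rw [key, hm.1 i j hij, mul_zero, zero_mul]
  · rw [key, hm.2 i, mul_one, toZMod_inv_mul]

theorem redM_diag_ne_zero {m : MM p N} (hm : m ∈ Ipre p N) (i : Fin N) :
    (redM p N m : Matrix (Fin N) (Fin N) (ZMod p)) i i ≠ 0 := by
  have hdet := ((Matrix.isUnit_iff_isUnit_det _).1 (redM p N m).isUnit).ne_zero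
  rw [Matrix.det_of_isUpperTriangular fun i j hij => hm i j hij] at hdet
  exact Finset.prod_ne_zero_iff.1 hdet i (Finset.mem_univ i)

theorem isUnit_of_toZMod_ne_zero {x : ℤ_[p]} (hx : PadicInt.toZMod x ≠ 0) : IsUnit x := by
  by_contra h
  apply hx
  rwa [← RingHom.mem_ker, PadicInt.ker_toZMod, IsLocalRing.mem_maximalIdeal]

/-- Every element of the Iwahori subgroup is the product of a diagonal element and an element
of the pro-p Iwahori subgroup. -/
theorem exists_eq_diagM_mul {m : MM p N} (hm : m ∈ Ipre p N) :
    ∃ (d : Fin N → ℤ_[p]ˣ) (u : MM p N), u ∈ I1pre p N ∧ m = diagM p N d * u ∧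
      ∀ τ : Fin N → Fin N, diagOf p N (diagM p N (d ∘ τ)) = diagOf p N m ∘ τ := by
  have hunit (i : Fin N) : IsUnit ((m : Matrix (Fin N) (Fin N) ℤ_[p]) i i) :=
    isUnit_of_toZMod_ne_zero (redM_diag_ne_zero hm i)
  choose d hd using hunit
  have key (i j : Fin N) : (redM p N ((diagM p N d)⁻¹ * m) :
      Matrix (Fin N) (Fin N) (ZMod p)) i j = PadicInt.toZMod (((d i)⁻¹ : ℤ_[p]ˣ) : ℤ_[p]) *
        (redM p N m : Matrix (Fin N) (Fin N) (ZMod p)) i j := by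
    rw [diagM_inv, map_mul, Units.val_mul, coe_redM_diagM, Matrix.diagonal_mul, Pi.inv_apply]
  refine ⟨d, (diagM p N d)⁻¹ * m, ⟨fun i j hij => ?_, fun i => ?_⟩,
    (mul_inv_cancel_left _ _).symm, fun τ => funext fun i => ?_⟩
  · rw [key, hm i j hij, mul_zero]
  · rw [key, coe_redM, Matrix.map_apply, ← hd, toZMod_inv_mul]
  · rw [Function.comp_apply, diagOf, diagOf, coe_redM_diagM, Matrix.diagonal_apply_eq,
      Function.comp_apply, hd, coe_redM, Matrix.map_apply]

section Rep

variable {V : Type} [AddCommGroup V] [Module (kb p) V]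

/-- A diagonal element acts on `f_{ω,a}` by a scalar at every point of its support. -/
theorem IsStd.apply_mul_diagM {ρ : Representation (kb p) (Gk p N) V} {v₀ : V}
    {ξ : (Fin N → (ZMod p)ˣ) →* (kb p)ˣ}
    (hχ : ∀ m ∈ Ipre p N, ρ (redM p N m) v₀ = (ξ (diagOf p N m) : kb p) • v₀)
    {ω : Equiv.Perm (Fin N)} {a : Fin (N - 1) → ℤ} {f : GG p N → V}
    (hf : IsStd p N ρ v₀ ω a f) (d : Fin N → ℤ_[p]ˣ) {x : GG p N} (hx : f x ≠ 0) :
    f (x * iotaM p N (diagM p N d)) =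
      (ξ (diagOf p N (diagM p N (d ∘ ⇑ω⁻¹))) : kb p) • f x := by
  obtain ⟨⟨hequiv, -, -⟩, hinv, hsupp, hval⟩ := hf
  obtain ⟨z, k, _, ⟨u, hu, rfl⟩, rfl⟩ := hsupp x hx
  have hu' : iotaM p N ((diagM p N d)⁻¹ * u * diagM p N d) ∈ I1set p N :=
    ⟨_, diagM_inv_mul_mul_mem_I1pre d hu, rfl⟩
  have ht : tGL p N a = iotaM p N (permM p N ω)⁻¹ * wS p N ω a := by
    rw [wS, map_inv, iotaM_permM, inv_mul_cancel_left]
  have h1 : piSc p N z * iotaM p N k * tGL p N a * iotaM p N u * iotaM p N (diagM p N d) =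
      piSc p N z * iotaM p N (k * (permM p N ω)⁻¹ * diagM p N (d ∘ ⇑ω⁻¹)) * wS p N ω a *
        iotaM p N ((diagM p N d)⁻¹ * u * diagM p N d) := by
    simp only [map_mul, map_inv, mul_assoc]
    rw [← mul_assoc (iotaM p N (diagM p N (d ∘ ⇑ω⁻¹))) (wS p N ω a), ← wS_mul_iotaM_diagM,
      ht, map_inv]
    simp only [mul_assoc, mul_inv_cancel_left]
  have h2 : piSc p N z * iotaM p N k * tGL p N a =
      piSc p N z * iotaM p N (k * (permM p N ω)⁻¹) * wS p N ω a := by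
    simp only [ht, map_mul, mul_assoc]
  rw [h1, hinv _ hu', hinv _ ⟨u, hu, rfl⟩, h2, hequiv, hequiv, hval, map_mul, map_mul,
    Module.End.mul_apply, hχ _ (diagM_mem_Ipre _), map_smul]

end Rep

end Iwahori

/-- `I` acts on `f_{ω,a}` through the character `χ_σ^ω`. -/
theorem stmt9 (p : ℕ) [Fact p.Prime] (n : ℕ)
    {V : Type} [AddCommGroup V] [Module (kb p) V] [FiniteDimensional (kb p) V]
    (ρ : Representation (kb p) (Gk p (n + 3)) V) (hirr : IsIrred p (n + 3) ρ)
    (v₀ : V) (hv₀ : v₀ ≠ 0)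
    (hfix : ∀ m ∈ I1pre p (n + 3), ρ (redM p (n + 3) m) v₀ = v₀)
    (ξ : (Fin (n + 3) → (ZMod p)ˣ) →* (kb p)ˣ)
    (hχ : ∀ m ∈ Ipre p (n + 3),
      ρ (redM p (n + 3) m) v₀ = (ξ (diagOf p (n + 3) m) : kb p) • v₀) :
    ∀ (ω : Equiv.Perm (Fin (n + 3))) (a : Fin (n + 2) → ℤ), a ∈ Sset p (n + 3) ω →
      ∀ f : GG p (n + 3) → V, IsStd p (n + 3) ρ v₀ ω a f →
        ∀ m ∈ Ipre p (n + 3), ∀ x : GG p (n + 3),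
          f (x * iotaM p (n + 3) m) = (ξ (diagOf p (n + 3) m ∘ ⇑ω⁻¹) : kb p) • f x := by
  intro ω a _ f hf m hm x
  obtain ⟨d, u, hu, rfl, hdiag⟩ := exists_eq_diagM_mul hm
  rw [← hdiag, map_mul, ← mul_assoc, hf.2.1 _ ⟨u, hu, rfl⟩]
  by_cases hx : f x = 0
  · rw [hx, smul_zero]
    by_contra hxd
    have h := hf.apply_mul_diagM hχ d⁻¹ hxd
    rw [← diagM_inv, map_inv, mul_inv_cancel_right, hx] at h
    exact smul_ne_zero (Units.ne_zero _) hxd h.symm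
  · exact hf.apply_mul_diagM hχ d hx

end IH
end
end
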